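/- arXiv:1609.05714 — 3 statements merged into one kernel-verified Lean document; each statement's English description precedes it below -/
import Mathlib

section
/- Let ξ_1,…,ξ_n be real random variables with E[ξ_i] = 0 for all i, let W = Σ_{i=1}^n ξ_i and assume Var(W) = 1. Suppose the local dependence condition (LD) holds: for each i ∈ {1,…,n} there exist sets A_i ⊂ B_i ⊂ {1,…,n} such that ξ_i is independent of the collection (ξ_j)_{j ∉ A_i} and the collection (ξ_j)_{j ∈ A_i} is independent of (ξ_j)_{j ∉ B_i}. Set η_i = Σ_{j ∈ A_i} ξ_j and τ_i = Σ_{j ∈ B_i} ξ_j. Then for Z a standard normal random variable, d_W(W, Z) ≤ 2 Σ_{i=1}^n ( E|ξ_i η_i τ_i| + |E(ξ_i η_i)| · E|τ_i| ) + Σ_{i=1}^n E|ξ_i η_i²|. -/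
open MeasureTheory ProbabilityTheory Real

noncomputable def stPhi (x : ℝ) : ℝ := gaussianPDFReal 0 1 x

lemma stPhi_eq (x : ℝ) : stPhi x = (√(2 * π))⁻¹ * Real.exp (-(1/2) * x ^ 2) := by
  simp only [stPhi, gaussianPDFReal]
  congr 1
  · simp
  · congr 1; simp; ring

lemma stPhi_pos (x : ℝ) : 0 < stPhi x := gaussianPDFReal_pos _ _ _ one_ne_zero

lemma stPhi_deriv (x : ℝ) : HasDerivAt stPhi (-x * stPhi x) x := by
  have : stPhi = fun x => (√(2 * π))⁻¹ * Real.exp (-(1/2) * x ^ 2) := funext stPhi_eq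
  rw [this]
  have h := (((hasDerivAt_id x).pow 2).const_mul (-(1/2:ℝ))).exp.const_mul ((√(2 * π))⁻¹)
  exact HasDerivAt.congr_deriv h (by simp; ring)

lemma stPhi_cont : Continuous stPhi :=
  continuous_iff_continuousAt.2 fun x => (stPhi_deriv x).continuousAt

lemma stPhi_int : Integrable stPhi := integrable_gaussianPDFReal 0 1

lemma stPhi_int1 : Integrable (fun t => t * stPhi t) := by
  have h := (integrable_mul_exp_neg_mul_sq (b := 1/2) (by norm_num)).const_mul ((√(2 * π))⁻¹)
  refine h.congr (ae_of_all _ fun t => ?_)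
  simp only [stPhi_eq]; ring

lemma stPhi_int2 : Integrable (fun t => t ^ 2 * stPhi t) := by
  have h := (integrable_rpow_mul_exp_neg_mul_sq (b := 1/2) (by norm_num) (s := 2) (by norm_num)).const_mul ((√(2 * π))⁻¹)
  refine h.congr (ae_of_all _ fun t => ?_)
  simp only [stPhi_eq, Real.rpow_ofNat]; ring

lemma stPhi_integral : ∫ t, stPhi t = 1 := integral_gaussianPDFReal_eq_one 0 one_ne_zero

lemma st_Iic1 (x : ℝ) : ∫ t in Set.Iic x, t * stPhi t = -stPhi x := by
  have hd : ∀ y, HasDerivAt (fun t => -stPhi t) (y * stPhi y) y := fun y => by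
    exact HasDerivAt.congr_deriv (stPhi_deriv y).neg (by ring)
  have h0 := tendsto_zero_of_hasDerivAt_of_integrableOn_Iic (a := x) (fun y _ => hd y)
    stPhi_int1.integrableOn stPhi_int.neg.integrableOn
  have := integral_Iic_of_hasDerivAt_of_tendsto' (a := x) (fun y _ => hd y)
    stPhi_int1.integrableOn h0
  simpa using this

lemma st_Ioi1 (x : ℝ) : ∫ t in Set.Ioi x, t * stPhi t = stPhi x := by
  have hd : ∀ y, HasDerivAt (fun t => -stPhi t) (y * stPhi y) y := fun y => by
    exact HasDerivAt.congr_deriv (stPhi_deriv y).neg (by ring)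
  have h0 := tendsto_zero_of_hasDerivAt_of_integrableOn_Ioi (a := x) (fun y _ => hd y)
    stPhi_int1.integrableOn stPhi_int.neg.integrableOn
  have := integral_Ioi_of_hasDerivAt_of_tendsto' (a := x) (fun y _ => hd y)
    stPhi_int1.integrableOn h0
  simpa using this

lemma st_Iic2 (x : ℝ) : ∫ t in Set.Iic x, (t ^ 2 * stPhi t - stPhi t) = - (x * stPhi x) := by
  have hd : ∀ y, HasDerivAt (fun t => -(t * stPhi t)) (y ^ 2 * stPhi y - stPhi y) y := fun y => by
    exact HasDerivAt.congr_deriv ((hasDerivAt_id y).mul (stPhi_deriv y)).neg (by simp; ring)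
  have hi := stPhi_int2.sub stPhi_int
  have h0 := tendsto_zero_of_hasDerivAt_of_integrableOn_Iic (a := x) (fun y _ => hd y)
    hi.integrableOn stPhi_int1.neg.integrableOn
  have := integral_Iic_of_hasDerivAt_of_tendsto' (a := x) (fun y _ => hd y)
    hi.integrableOn h0
  simpa using this

lemma st_Ioi2 (x : ℝ) : ∫ t in Set.Ioi x, (t ^ 2 * stPhi t - stPhi t) = x * stPhi x := by
  have hd : ∀ y, HasDerivAt (fun t => -(t * stPhi t)) (y ^ 2 * stPhi y - stPhi y) y := fun y => by
    exact HasDerivAt.congr_deriv ((hasDerivAt_id y).mul (stPhi_deriv y)).neg (by simp; ring)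
  have hi := stPhi_int2.sub stPhi_int
  have h0 := tendsto_zero_of_hasDerivAt_of_integrableOn_Ioi (a := x) (fun y _ => hd y)
    hi.integrableOn stPhi_int1.neg.integrableOn
  have := integral_Ioi_of_hasDerivAt_of_tendsto' (a := x) (fun y _ => hd y)
    hi.integrableOn h0
  simpa using this

lemma st_sq (s : Set ℝ) (x : ℝ) :
    0 ≤ (∫ t in s, (t ^ 2 * stPhi t - stPhi t)) - 2 * x * (∫ t in s, t * stPhi t)
      + (1 + x ^ 2) * ∫ t in s, stPhi t := by
  have h : 0 ≤ ∫ t in s, (t - x) ^ 2 * stPhi t :=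
    integral_nonneg fun t => mul_nonneg (sq_nonneg _) (stPhi_pos t).le
  have e : ∫ t in s, (t - x) ^ 2 * stPhi t = ∫ t in s, (((t ^ 2 * stPhi t - stPhi t)
      - 2 * x * (t * stPhi t)) + (1 + x ^ 2) * stPhi t) :=
    integral_congr_ae (ae_of_all _ fun t => by simp only; ring)
  rw [e, integral_add, integral_sub, integral_const_mul, integral_const_mul] at h
  · linarith
  · exact (stPhi_int2.sub stPhi_int).integrableOn
  · exact (stPhi_int1.const_mul _).integrableOn
  · exact ((stPhi_int2.sub stPhi_int).sub (stPhi_int1.const_mul _)).integrableOn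
  · exact (stPhi_int.const_mul _).integrableOn

lemma st_deriv_Iic (g : ℝ → ℝ) (hg : Continuous g) (hi : Integrable g) (x : ℝ) :
    HasDerivAt (fun x => ∫ t in Set.Iic x, g t) (g x) x := by
  have e : (fun x => ∫ t in Set.Iic x, g t)
      = fun x => (∫ t in Set.Iic 0, g t) + ∫ t in (0:ℝ)..x, g t := by
    funext y
    rw [← intervalIntegral.integral_Iic_sub_Iic hi.integrableOn hi.integrableOn]; ring
  rw [e]
  exact (hg.integral_hasStrictDerivAt 0 x).hasDerivAt.const_add _

lemma st_lip_bound {h : ℝ → ℝ} (hL : LipschitzWith 1 h) (x y : ℝ) : |h x - h y| ≤ |x - y| := by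
  simpa [Real.dist_eq] using hL.dist_le_mul x y

lemma st_hint {h : ℝ → ℝ} (hL : LipschitzWith 1 h) : Integrable (fun t => h t * stPhi t) := by
  have hb : Integrable (fun t => |h 0| * stPhi t + |t * stPhi t|) :=
    (stPhi_int.const_mul _).add stPhi_int1.abs
  refine hb.mono' (hL.continuous.mul stPhi_cont).aestronglyMeasurable (ae_of_all _ fun t => ?_)
  have h1 := st_lip_bound hL t 0
  have h2 : |h t| ≤ |h 0| + |t| := by
    have := abs_sub_abs_le_abs_sub (h t) (h 0)
    simp at h1; linarith
  have h3 := stPhi_pos t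
  simp only [Real.norm_eq_abs, abs_mul, abs_of_pos h3]
  nlinarith

lemma stein_solution (h h' : ℝ → ℝ) (hL : LipschitzWith 1 h) (hd : ∀ x, HasDerivAt h (h' x) x)
    (hb : ∀ x, |h' x| ≤ 1) :
    ∃ f f' f'' : ℝ → ℝ, (∀ x, HasDerivAt f (f' x) x) ∧ (∀ x, HasDerivAt f' (f'' x) x) ∧
      (∀ x, |f x| ≤ 1) ∧ (∀ x, |f'' x| ≤ 2) ∧
      ∀ x, f' x - x * f x = h x - ∫ t, h t ∂(gaussianReal 0 1) := by
  set c := ∫ t, h t ∂(gaussianReal 0 1) with hc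
  have hci : ∫ t, h t * stPhi t = c := by
    rw [hc, integral_gaussianReal_eq_integral_smul one_ne_zero]
    simp only [smul_eq_mul, mul_comm, stPhi]
  let U : ℝ → ℝ := fun x => ∫ t in Set.Iic x, stPhi t
  let V : ℝ → ℝ := fun x => ∫ t in Set.Ioi x, stPhi t
  let I : ℝ → ℝ := fun x => ∫ t in Set.Iic x, h t * stPhi t
  let J : ℝ → ℝ := fun x => ∫ t in Set.Ioi x, h t * stPhi t
  have hUV : ∀ x, U x + V x = 1 := fun x => by
    rw [← stPhi_integral]
    exact intervalIntegral.integral_Iic_add_Ioi stPhi_int.integrableOn stPhi_int.integrableOn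
  have hIJ : ∀ x, I x + J x = c := fun x => by
    rw [← hci]
    exact intervalIntegral.integral_Iic_add_Ioi (st_hint hL).integrableOn (st_hint hL).integrableOn
  have dU : ∀ x, HasDerivAt U (stPhi x) x := st_deriv_Iic _ stPhi_cont stPhi_int
  have dI : ∀ x, HasDerivAt I (h x * stPhi x) x :=
    st_deriv_Iic _ (hL.continuous.mul stPhi_cont) (st_hint hL)
  have hU0 : ∀ x, 0 ≤ U x := fun x => integral_nonneg fun t => (stPhi_pos t).le
  have hV0 : ∀ x, 0 ≤ V x := fun x => integral_nonneg fun t => (stPhi_pos t).le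
  have hP : ∀ x, |h x * U x - I x| ≤ x * U x + stPhi x := fun x => by
    have e1 : h x * U x - I x = ∫ t in Set.Iic x, (h x * stPhi t - h t * stPhi t) := by
      rw [integral_sub (stPhi_int.const_mul _).integrableOn (st_hint hL).integrableOn,
        integral_const_mul]
    have e2 : x * U x + stPhi x = ∫ t in Set.Iic x, (x * stPhi t - t * stPhi t) := by
      rw [integral_sub (stPhi_int.const_mul _).integrableOn stPhi_int1.integrableOn,
        integral_const_mul, st_Iic1]; simp [U]
    rw [e1, e2]
    refine (norm_integral_le_integral_norm _).trans (setIntegral_mono_on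
      ((stPhi_int.const_mul _).sub (st_hint hL)).norm.integrableOn
      ((stPhi_int.const_mul _).sub stPhi_int1).integrableOn measurableSet_Iic fun t ht => ?_)
    simp only [Pi.sub_apply]
    rw [← sub_mul, ← sub_mul, Real.norm_eq_abs, abs_mul, abs_of_pos (stPhi_pos t)]
    refine mul_le_mul_of_nonneg_right ((st_lip_bound hL x t).trans_eq ?_) (stPhi_pos t).le
    exact abs_of_nonneg (sub_nonneg.2 ht)
  have hQ : ∀ x, |J x - h x * V x| ≤ stPhi x - x * V x := fun x => by
    have e1 : J x - h x * V x = ∫ t in Set.Ioi x, (h t * stPhi t - h x * stPhi t) := by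
      rw [integral_sub (st_hint hL).integrableOn (stPhi_int.const_mul _).integrableOn,
        integral_const_mul]
    have e2 : stPhi x - x * V x = ∫ t in Set.Ioi x, (t * stPhi t - x * stPhi t) := by
      rw [integral_sub stPhi_int1.integrableOn (stPhi_int.const_mul _).integrableOn,
        integral_const_mul, st_Ioi1]
    rw [e1, e2]
    refine (norm_integral_le_integral_norm _).trans (setIntegral_mono_on
      ((st_hint hL).sub (stPhi_int.const_mul _)).norm.integrableOn
      (stPhi_int1.sub (stPhi_int.const_mul _)).integrableOn measurableSet_Ioi fun t ht => ?_)
    simp only [Pi.sub_apply]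
    rw [← sub_mul, ← sub_mul, Real.norm_eq_abs, abs_mul, abs_of_pos (stPhi_pos t)]
    refine mul_le_mul_of_nonneg_right ((st_lip_bound hL t x).trans_eq ?_) (stPhi_pos t).le
    exact abs_of_nonneg (sub_nonneg.2 (le_of_lt ht))
  have hb1 : ∀ x, 0 ≤ (1 + x ^ 2) * U x + x * stPhi x := fun x => by
    have := st_sq (Set.Iic x) x
    rw [st_Iic1, st_Iic2] at this
    simp only [U]; linarith
  have ha1 : ∀ x, 0 ≤ (1 + x ^ 2) * V x - x * stPhi x := fun x => by
    have := st_sq (Set.Ioi x) x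
    rw [st_Ioi1, st_Ioi2] at this
    simp only [V]; linarith
  let f : ℝ → ℝ := fun x => (I x - c * U x) / stPhi x
  let f' : ℝ → ℝ := fun x => x * f x + (h x - c)
  have df : ∀ x, HasDerivAt f (f' x) x := fun x => by
    have h1 := ((dI x).sub ((dU x).const_mul c)).div (stPhi_deriv x) (stPhi_pos x).ne'
    refine HasDerivAt.congr_deriv h1 ?_
    have := (stPhi_pos x).ne'
    simp only [f', f]
    simp only [Pi.sub_apply]
    field_simp
    ring
  refine ⟨f, f', fun x => f x + x * f' x + h' x, df, fun x => ?_, fun x => ?_, fun x => ?_,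
    fun x => by simp [f']⟩
  · exact HasDerivAt.congr_deriv (((hasDerivAt_id x).mul (df x)).add ((hd x).sub_const c)) (by simp)
  · have p := stPhi_pos x
    have key : I x - c * U x = -(V x * (h x * U x - I x) + U x * (J x - h x * V x)) := by
      rw [← hIJ x]; linear_combination (I x) * (hUV x).symm
    simp only [f]
    rw [abs_div, abs_of_pos p, div_le_one p, key, abs_neg]
    calc _ ≤ V x * |h x * U x - I x| + U x * |J x - h x * V x| := by
          refine (abs_add_le _ _).trans_eq ?_
          rw [abs_mul, abs_mul, abs_of_nonneg (hU0 x), abs_of_nonneg (hV0 x)]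
      _ ≤ V x * (x * U x + stPhi x) + U x * (stPhi x - x * V x) := by
          gcongr
          exacts [hV0 x, hP x, hU0 x, hQ x]
      _ = stPhi x := by linear_combination (stPhi x) * hUV x
  · have p := stPhi_pos x
    have key : I x - c * U x = -(V x * (h x * U x - I x) + U x * (J x - h x * V x)) := by
      rw [← hIJ x]; linear_combination (I x) * (hUV x).symm
    have key2 : h x - c = (h x * U x - I x) - (J x - h x * V x) := by
      rw [← hIJ x]; linear_combination (h x) * (hUV x).symm
    have e : (f x + x * f' x) * stPhi x = -(((1 + x ^ 2) * V x - x * stPhi x) * (h x * U x - I x)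
        + ((1 + x ^ 2) * U x + x * stPhi x) * (J x - h x * V x)) := by
      have : f x * stPhi x = I x - c * U x := div_mul_cancel₀ _ p.ne'
      simp only [f']
      rw [key] at this
      linear_combination (1 + x ^ 2) * this + x * stPhi x * key2
    have b : |f x + x * f' x| * stPhi x ≤ 1 * stPhi x := by
      rw [← abs_of_pos p, ← abs_mul, abs_of_pos p, e, abs_neg]
      calc _ ≤ ((1 + x ^ 2) * V x - x * stPhi x) * |h x * U x - I x|
              + ((1 + x ^ 2) * U x + x * stPhi x) * |J x - h x * V x| := by
            refine (abs_add_le _ _).trans_eq ?_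
            rw [abs_mul, abs_mul, abs_of_nonneg (ha1 x), abs_of_nonneg (hb1 x)]
        _ ≤ ((1 + x ^ 2) * V x - x * stPhi x) * (x * U x + stPhi x)
              + ((1 + x ^ 2) * U x + x * stPhi x) * (stPhi x - x * V x) :=
            add_le_add (mul_le_mul_of_nonneg_left (hP x) (ha1 x))
              (mul_le_mul_of_nonneg_left (hQ x) (hb1 x))
        _ = 1 * stPhi x := by linear_combination (stPhi x) * hUV x
    have b' := le_of_mul_le_mul_right b p
    calc _ ≤ |f x + x * f' x| + |h' x| := abs_add_le _ _
      _ ≤ 2 := by linarith [hb x]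

lemma st_taylor_aux (f f' : ℝ → ℝ) (h1 : ∀ x, HasDerivAt f (f' x) x)
    (h2 : ∀ x y, |f' x - f' y| ≤ 2 * |x - y|) (w z : ℝ) :
    0 ≤ f z - f w - f' w * (z - w) + (z - w) ^ 2 := by
  have hu : ∀ y, HasDerivAt (fun z => f z - f w - f' w * (z - w) + (z - w) ^ 2)
      (f' y - f' w + 2 * (y - w)) y := fun y => by
    refine HasDerivAt.congr_deriv ((((h1 y).sub_const (f w)).sub (((hasDerivAt_id y).sub_const w).const_mul (f' w))).add
      (((hasDerivAt_id y).sub_const w).pow 2)) ?_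
    simp
  have hc : Continuous (fun z => f z - f w - f' w * (z - w) + (z - w) ^ 2) :=
    continuous_iff_continuousAt.2 fun y => (hu y).continuousAt
  rcases lt_trichotomy w z with h | h | h
  · obtain ⟨y, hy, e⟩ := exists_hasDerivAt_eq_slope _ _ h hc.continuousOn fun y _ => hu y
    rw [eq_div_iff (sub_pos.2 h).ne'] at e
    have := h2 y w
    rw [abs_of_pos (sub_pos.2 hy.1)] at this
    have := (abs_le.1 this).1
    have : 0 ≤ (f' y - f' w + 2 * (y - w)) * (z - w) :=
      mul_nonneg (by linarith) (sub_pos.2 h).le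
    simp at e
    linarith
  · subst h; simp
  · obtain ⟨y, hy, e⟩ := exists_hasDerivAt_eq_slope _ _ h hc.continuousOn fun y _ => hu y
    rw [eq_div_iff (sub_pos.2 h).ne'] at e
    have := h2 y w
    rw [abs_of_neg (sub_neg.2 hy.2)] at this
    have := (abs_le.1 this).2
    have : (f' y - f' w + 2 * (y - w)) * (w - z) ≤ 0 :=
      mul_nonpos_of_nonpos_of_nonneg (by linarith) (sub_pos.2 h).le
    simp at e
    linarith

lemma st_taylor (f f' : ℝ → ℝ) (h1 : ∀ x, HasDerivAt f (f' x) x)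
    (h2 : ∀ x y, |f' x - f' y| ≤ 2 * |x - y|) (w e : ℝ) :
    |f w - f (w - e) - e * f' w| ≤ e ^ 2 := by
  have a := st_taylor_aux f f' h1 h2 w (w - e)
  have b := st_taylor_aux (fun x => -f x) (fun x => -f' x) (fun x => (h1 x).neg)
    (fun x y => by rw [neg_sub_neg, abs_sub_comm]; exact h2 x y) w (w - e)
  rw [abs_le]
  constructor <;> nlinarith

lemma st_smooth {h : ℝ → ℝ} (hL : LipschitzWith 1 h) {ε : ℝ} (hε : 0 < ε) :
    ∃ g g' : ℝ → ℝ, LipschitzWith 1 g ∧ (∀ x, HasDerivAt g (g' x) x) ∧ (∀ x, |g' x| ≤ 1) ∧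
      ∀ x, |g x - h x| ≤ ε := by
  have hc := hL.continuous
  have hd : ∀ x, HasDerivAt (fun x => ε⁻¹ * ∫ t in x..(x + ε), h t) (ε⁻¹ * (h (x + ε) - h x)) x := by
    intro x
    have e : (fun x => ∫ t in x..(x + ε), h t)
        = fun x => (∫ t in (0:ℝ)..(x + ε), h t) - ∫ t in (0:ℝ)..x, h t := by
      funext y
      rw [intervalIntegral.integral_interval_sub_left] <;> exact hc.intervalIntegrable _ _
    have h1 := (hc.integral_hasStrictDerivAt 0 x).hasDerivAt
    have h2 := (hc.integral_hasStrictDerivAt 0 (x + ε)).hasDerivAt.comp_add_const x ε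
    have h3 := h2.sub h1
    have : HasDerivAt (fun x => ∫ t in x..(x + ε), h t) (h (x + ε) - h x) x := by
      rw [e]; exact h3
    exact this.const_mul _
  have hb : ∀ x, |ε⁻¹ * (h (x + ε) - h x)| ≤ 1 := fun x => by
    have := st_lip_bound hL (x + ε) x
    rw [add_sub_cancel_left, abs_of_pos hε] at this
    rw [abs_mul, abs_of_pos (inv_pos.2 hε), inv_mul_le_one₀ hε]
    exact this
  refine ⟨_, _, ?_, hd, hb, fun x => ?_⟩
  · refine lipschitzWith_of_nnnorm_deriv_le (fun x => (hd x).differentiableAt) fun x => ?_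
    rw [(hd x).deriv]
    exact_mod_cast hb x
  · have e : (ε⁻¹ * ∫ t in x..(x + ε), h t) - h x = ε⁻¹ * ∫ t in x..(x + ε), (h t - h x) := by
      rw [intervalIntegral.integral_sub (hc.intervalIntegrable _ _) (by simp)]
      simp; field_simp
    have := intervalIntegral.norm_integral_le_of_norm_le_const (a := x) (b := x + ε) (C := ε)
      (f := fun t => h t - h x) (fun t ht => by
        rw [Set.uIoc_of_le (by linarith)] at ht
        refine (st_lip_bound hL t x).trans ?_
        rw [abs_of_pos (sub_pos.2 ht.1)]; linarith [ht.2])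
    rw [add_sub_cancel_left, abs_of_pos hε, Real.norm_eq_abs] at this
    rw [e, abs_mul, abs_of_pos (inv_pos.2 hε), inv_mul_le_iff₀ hε]
    exact this

lemma st_local {Ω : Type*} [MeasurableSpace Ω] (μ : Measure Ω) [IsProbabilityMeasure μ]
    (X e t W : Ω → ℝ) (hXm : Measurable X) (hem : Measurable e) (htm : Measurable t)
    (hWm : Measurable W) (hX0 : ∫ ω, X ω ∂μ = 0)
    (i1 : IndepFun X (fun ω => W ω - e ω) μ)
    (i2 : IndepFun (fun ω => X ω * e ω) (fun ω => W ω - t ω) μ)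
    (hXet : Integrable (fun ω => X ω * e ω * t ω) μ)
    (hXe : Integrable (fun ω => X ω * e ω) μ) (ht : Integrable t μ)
    (hXee : Integrable (fun ω => X ω * (e ω) ^ 2) μ) (hX : Integrable X μ) (hWi : Integrable W μ)
    (f f' : ℝ → ℝ) (hf : ∀ x, HasDerivAt f (f' x) x)
    (hf' : ∀ x y, |f' x - f' y| ≤ 2 * |x - y|) (hf'c : Continuous f') (hfb : ∀ x, |f x| ≤ 1) :
    |(∫ ω, X ω * e ω ∂μ) * (∫ ω, f' (W ω) ∂μ) - ∫ ω, X ω * f (W ω) ∂μ|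
      ≤ 2 * ((∫ ω, |X ω * e ω * t ω| ∂μ) + |∫ ω, X ω * e ω ∂μ| * ∫ ω, |t ω| ∂μ)
        + ∫ ω, |X ω * (e ω) ^ 2| ∂μ := by
  have hfc : Continuous f := continuous_iff_continuousAt.2 fun x => (hf x).continuousAt
  have hfm := hfc.measurable
  have hf'm := hf'c.measurable
  have hlin : ∀ Y : Ω → ℝ, Measurable Y → Integrable Y μ → Integrable (fun ω => f' (Y ω)) μ := by
    intro Y hY hYi
    refine ((integrable_const (|f' 0|)).add (hYi.abs.const_mul 2)).mono'
      (hf'm.comp hY).aestronglyMeasurable (ae_of_all _ fun ω => ?_)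
    have h1 := hf' (Y ω) 0
    have := abs_sub_abs_le_abs_sub (f' (Y ω)) (f' 0)
    simp at h1 ⊢
    linarith
  have hA := hlin W hWm hWi
  have hB := hlin (fun ω => W ω - t ω) (hWm.sub htm) (hWi.sub ht)
  have hI2 : Integrable (fun ω => X ω * f (W ω - e ω)) μ := by
    refine hX.abs.mono' (hXm.mul (hfm.comp (hWm.sub hem))).aestronglyMeasurable
      (ae_of_all _ fun ω => ?_)
    rw [Real.norm_eq_abs, abs_mul]
    exact mul_le_of_le_one_right (abs_nonneg _) (hfb _)
  have hE2 : ∫ ω, X ω * f (W ω - e ω) ∂μ = 0 := by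
    have := (i1.comp measurable_id hfm).integral_fun_mul_eq_mul_integral
      hXm.aestronglyMeasurable (hfm.comp (hWm.sub hem)).aestronglyMeasurable
    simp only [Function.comp_def, id] at this
    rw [this, hX0, zero_mul]
  have i3 := i2.comp measurable_id hf'm
  have hI3 : Integrable (fun ω => X ω * e ω * f' (W ω - t ω)) μ := i3.integrable_mul hXe hB
  have hE3 : ∫ ω, X ω * e ω * f' (W ω - t ω) ∂μ
      = (∫ ω, X ω * e ω ∂μ) * ∫ ω, f' (W ω - t ω) ∂μ := by
    have := i3.integral_fun_mul_eq_mul_integral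
      (hXm.mul hem).aestronglyMeasurable (hf'm.comp (hWm.sub htm)).aestronglyMeasurable
    simpa only [Function.comp_def, id] using this
  have bR : ∀ ω, |X ω * (f (W ω) - f (W ω - e ω) - e ω * f' (W ω))| ≤ |X ω * (e ω) ^ 2| := by
    intro ω
    rw [abs_mul, abs_mul]
    refine mul_le_mul_of_nonneg_left ((st_taylor f f' hf hf' _ _).trans (le_abs_self _))
      (abs_nonneg _)
  have hR : Integrable (fun ω => X ω * (f (W ω) - f (W ω - e ω) - e ω * f' (W ω))) μ :=
    hXee.abs.mono' (by fun_prop) (ae_of_all _ bR)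
  have bL : ∀ ω, |f' (W ω) - f' (W ω - t ω)| ≤ 2 * |t ω| := fun ω => by
    simpa using hf' (W ω) (W ω - t ω)
  have bD : ∀ ω, |X ω * e ω * (f' (W ω) - f' (W ω - t ω))| ≤ 2 * |X ω * e ω * t ω| := by
    intro ω
    rw [abs_mul, abs_mul (X ω * e ω)]
    nlinarith [bL ω, abs_nonneg (X ω * e ω)]
  have hD : Integrable (fun ω => X ω * e ω * (f' (W ω) - f' (W ω - t ω))) μ :=
    (hXet.abs.const_mul 2).mono' (by fun_prop) (ae_of_all _ bD)
  have hsum : ∫ ω, X ω * f (W ω) ∂μ =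
      (∫ ω, X ω * (f (W ω) - f (W ω - e ω) - e ω * f' (W ω)) ∂μ)
      + (∫ ω, X ω * e ω * (f' (W ω) - f' (W ω - t ω)) ∂μ)
      + (∫ ω, X ω * e ω ∂μ) * ∫ ω, f' (W ω - t ω) ∂μ := by
    have q1 := integral_add' hR hD
    have q2 := integral_add' (hR.add hD) hI3
    have q3 := integral_add' ((hR.add hD).add hI3) hI2
    rw [← hE3, ← q1, ← q2, ← add_zero (∫ ω, (_ + _ : Ω → ℝ) ω ∂μ), ← hE2, ← q3]
    exact integral_congr_ae (ae_of_all _ fun ω => by simp only [Pi.add_apply]; ring)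
  have eR : |∫ ω, X ω * (f (W ω) - f (W ω - e ω) - e ω * f' (W ω)) ∂μ|
      ≤ ∫ ω, |X ω * (e ω) ^ 2| ∂μ :=
    (norm_integral_le_integral_norm _).trans (integral_mono hR.norm hXee.abs bR)
  have eD : |∫ ω, X ω * e ω * (f' (W ω) - f' (W ω - t ω)) ∂μ|
      ≤ 2 * ∫ ω, |X ω * e ω * t ω| ∂μ := by
    rw [← integral_const_mul]
    exact (norm_integral_le_integral_norm _).trans
      (integral_mono hD.norm (hXet.abs.const_mul 2) bD)
  have eL : |(∫ ω, f' (W ω) ∂μ) - ∫ ω, f' (W ω - t ω) ∂μ| ≤ 2 * ∫ ω, |t ω| ∂μ := by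
    rw [← integral_const_mul, ← integral_sub hA hB]
    exact (norm_integral_le_integral_norm _).trans
      (integral_mono (hA.sub hB).norm (ht.abs.const_mul 2) bL)
  rw [hsum]
  set m := ∫ ω, X ω * e ω ∂μ
  have eM := mul_le_mul_of_nonneg_left eL (abs_nonneg m)
  rw [← abs_mul] at eM
  generalize (∫ ω, X ω * (f (W ω) - f (W ω - e ω) - e ω * f' (W ω)) ∂μ) = R at *
  generalize (∫ ω, X ω * e ω * (f' (W ω) - f' (W ω - t ω)) ∂μ) = D at *
  rw [abs_le] at *
  constructor <;> linarith

lemma st_main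
    {Ω : Type*} [MeasurableSpace Ω] (μ : Measure Ω) [IsProbabilityMeasure μ]
    (n : ℕ) (ξ : Fin n → Ω → ℝ)
    (hmeas : ∀ i, Measurable (ξ i))
    (hmean : ∀ i, ∫ ω, ξ i ω ∂μ = 0)
    (W : Ω → ℝ) (hW : ∀ ω, W ω = ∑ i, ξ i ω)
    (hvarW : variance W μ = 1)
    (A B : Fin n → Finset (Fin n))
    (hLD1 : ∀ i, IndepFun (ξ i) (fun ω => fun j : {j : Fin n // j ∉ A i} => ξ j ω) μ)
    (hLD2 : ∀ i, IndepFun (fun ω => fun j : {j : Fin n // j ∈ A i} => ξ j ω)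
                          (fun ω => fun j : {j : Fin n // j ∉ B i} => ξ j ω) μ)
    (η τ : Fin n → Ω → ℝ)
    (hη : ∀ i ω, η i ω = ∑ j ∈ A i, ξ j ω)
    (hτ : ∀ i ω, τ i ω = ∑ j ∈ B i, ξ j ω)
    (hint1 : ∀ i, Integrable (fun ω => ξ i ω * η i ω * τ i ω) μ)
    (hint2 : ∀ i, Integrable (fun ω => ξ i ω * η i ω) μ)
    (hint3 : ∀ i, Integrable (τ i) μ)
    (hint4 : ∀ i, Integrable (fun ω => ξ i ω * (η i ω) ^ 2) μ)
    (hint0 : ∀ i, Integrable (ξ i) μ) (h h' : ℝ → ℝ) (hL : LipschitzWith 1 h)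
    (hd : ∀ x, HasDerivAt h (h' x) x) (hb : ∀ x, |h' x| ≤ 1) :
      |(∫ ω, h (W ω) ∂μ) - ∫ x, h x ∂(gaussianReal 0 1)|
        ≤ 2 * (∑ i, ((∫ ω, |ξ i ω * η i ω * τ i ω| ∂μ)
                      + |∫ ω, ξ i ω * η i ω ∂μ| * ∫ ω, |τ i ω| ∂μ))
          + ∑ i, ∫ ω, |ξ i ω * (η i ω) ^ 2| ∂μ := by
  obtain ⟨f, f', f'', df, df', fb, f''b, hst⟩ := stein_solution h h' hL hd hb
  have hWe : W = fun ω => ∑ i, ξ i ω := funext hW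
  have hηe : ∀ i, η i = fun ω => ∑ j ∈ A i, ξ j ω := fun i => funext (hη i)
  have hτe : ∀ i, τ i = fun ω => ∑ j ∈ B i, ξ j ω := fun i => funext (hτ i)
  have hWm : Measurable W := by rw [hWe]; fun_prop
  have hηm : ∀ i, Measurable (η i) := fun i => by rw [hηe]; fun_prop
  have hτm : ∀ i, Measurable (τ i) := fun i => by rw [hτe]; fun_prop
  have hWi : Integrable W μ := by rw [hWe]; exact integrable_finsetSum _ fun i _ => hint0 i
  have hηi : ∀ i, Integrable (η i) μ := fun i => by
    rw [hηe]; exact integrable_finsetSum _ fun i _ => hint0 i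
  have hW0 : ∫ ω, W ω ∂μ = 0 := by
    rw [hWe, integral_finsetSum _ fun i _ => hint0 i]; simp [hmean]
  have hcompl : ∀ (S : Finset (Fin n)) ω, (∑ j : {j : Fin n // j ∉ S}, ξ j ω)
      = W ω - ∑ j ∈ S, ξ j ω := fun S ω => by
    rw [hW, eq_sub_iff_add_eq, ← Finset.sum_subtype Sᶜ (by simp) (fun j => ξ j ω)]
    exact Finset.sum_compl_add_sum S _
  have hsm : ∀ S : Finset (Fin n),
      Measurable (fun v : {j : Fin n // j ∉ S} → ℝ => ∑ j, v j) := fun S => by fun_prop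
  have i1 : ∀ i, IndepFun (ξ i) (fun ω => W ω - η i ω) μ := fun i => by
    have := (hLD1 i).comp measurable_id (hsm (A i))
    simpa only [Function.comp_def, id, hcompl, ← hη] using this
  have i2 : ∀ i, IndepFun (fun ω => ξ i ω * η i ω) (fun ω => W ω - τ i ω) μ := fun i => by
    by_cases hi : i ∈ A i
    · have := (hLD2 i).comp (φ := fun v : {j : Fin n // j ∈ A i} → ℝ => v ⟨i, hi⟩ * ∑ j, v j)
        (by fun_prop) (hsm (B i))
      simp only [Function.comp_def, hcompl, ← hτ] at this
      have e : ∀ ω, (∑ j : {j : Fin n // j ∈ A i}, ξ j ω) = η i ω := fun ω => by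
        rw [hη, ← Finset.sum_subtype (A i) (by simp) (fun j => ξ j ω)]
      simpa only [e] using this
    · have hs := (hLD1 i).comp measurable_id
        (measurable_pi_apply (⟨i, hi⟩ : {j : Fin n // j ∉ A i}))
      have hs' : IndepFun (ξ i) (ξ i) μ := hs
      have hsi : Integrable (fun ω => ξ i ω * ξ i ω) μ := hs'.integrable_mul (hint0 i) (hint0 i)
      have h0 : ∫ ω, ξ i ω * ξ i ω ∂μ = 0 := by
        rw [hs'.integral_fun_mul_eq_mul_integral (hmeas i).aestronglyMeasurable
          (hmeas i).aestronglyMeasurable, hmean, zero_mul]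
      have h1 := (integral_eq_zero_iff_of_nonneg (fun ω => mul_self_nonneg (ξ i ω)) hsi).1 h0
      have h2 : (fun _ => (0:ℝ)) =ᵐ[μ] fun ω => ξ i ω * η i ω := by
        filter_upwards [h1] with ω hω
        rw [mul_self_eq_zero.1 hω, zero_mul]
      exact (indepFun_const_left (0:ℝ) (fun ω => W ω - τ i ω)).congr h2 (ae_eq_refl _)
  have iWe : ∀ i, Integrable (fun ω => ξ i ω * (W ω - η i ω)) μ := fun i =>
    (i1 i).integrable_mul (hint0 i) (hWi.sub (hηi i))
  have eWe : ∀ i, ∫ ω, ξ i ω * W ω ∂μ = ∫ ω, ξ i ω * η i ω ∂μ := fun i => by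
    have h0 : ∫ ω, ξ i ω * (W ω - η i ω) ∂μ = 0 := by
      rw [(i1 i).integral_fun_mul_eq_mul_integral (hmeas i).aestronglyMeasurable
        (hWm.sub (hηm i)).aestronglyMeasurable, hmean, zero_mul]
    rw [← add_zero (∫ ω, ξ i ω * η i ω ∂μ), ← h0, ← integral_add (hint2 i) (iWe i)]
    exact integral_congr_ae (ae_of_all _ fun ω => by simp only; ring)
  have iW : ∀ i, Integrable (fun ω => ξ i ω * W ω) μ := fun i => by
    refine ((hint2 i).add (iWe i)).congr (ae_of_all _ fun ω => ?_)
    simp only [Pi.add_apply]; ring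
  have hm1 : ∑ i, ∫ ω, ξ i ω * η i ω ∂μ = 1 := by
    rw [← hvarW, variance_of_integral_eq_zero hWm.aemeasurable hW0]
    simp only [← eWe]
    rw [← integral_finsetSum _ fun i _ => iW i]
    refine integral_congr_ae (ae_of_all _ fun ω => ?_)
    simp only
    rw [← Finset.sum_mul, ← hW, sq]
  have f'L : ∀ x y, |f' x - f' y| ≤ 2 * |x - y| := fun x y => by
    have := Convex.norm_image_sub_le_of_norm_hasDerivWithin_le (s := Set.univ) (C := 2) (x := y)
      (y := x) (f := f') (f' := f'') (fun x _ => (df' x).hasDerivWithinAt) (fun x _ => f''b x)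
      convex_univ trivial trivial
    simpa using this
  have f'c : Continuous f' := continuous_iff_continuousAt.2 fun x => (df' x).continuousAt
  have fc : Continuous f := continuous_iff_continuousAt.2 fun x => (df x).continuousAt
  have fm := fc.measurable
  have hf'i : Integrable (fun ω => f' (W ω)) μ := by
    refine ((integrable_const (|f' 0|)).add (hWi.abs.const_mul 2)).mono'
      (f'c.measurable.comp hWm).aestronglyMeasurable (ae_of_all _ fun ω => ?_)
    have h1 := f'L (W ω) 0
    have := abs_sub_abs_le_abs_sub (f' (W ω)) (f' 0)
    simp at h1 ⊢
    linarith
  have hfi : ∀ i, Integrable (fun ω => ξ i ω * f (W ω)) μ := fun i => by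
    refine (hint0 i).abs.mono' ((hmeas i).mul (fm.comp hWm)).aestronglyMeasurable
      (ae_of_all _ fun ω => ?_)
    rw [Real.norm_eq_abs, abs_mul]
    exact mul_le_of_le_one_right (abs_nonneg _) (fb _)
  have hhi : Integrable (fun ω => h (W ω)) μ := by
    refine ((integrable_const (|h 0|)).add hWi.abs).mono'
      (hL.continuous.measurable.comp hWm).aestronglyMeasurable (ae_of_all _ fun ω => ?_)
    have h1 := st_lip_bound hL (W ω) 0
    have := abs_sub_abs_le_abs_sub (h (W ω)) (h 0)
    simp at h1 ⊢
    linarith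
  have key : (∫ ω, h (W ω) ∂μ) - ∫ x, h x ∂(gaussianReal 0 1)
      = ∑ i, ((∫ ω, ξ i ω * η i ω ∂μ) * (∫ ω, f' (W ω) ∂μ) - ∫ ω, ξ i ω * f (W ω) ∂μ) := by
    rw [Finset.sum_sub_distrib, ← Finset.sum_mul, hm1, one_mul,
      ← integral_finsetSum _ fun i _ => hfi i,
      ← integral_sub hf'i (integrable_finsetSum _ fun i _ => hfi i)]
    have : (∫ ω, h (W ω) ∂μ) - ∫ x, h x ∂(gaussianReal 0 1)
        = ∫ ω, (h (W ω) - ∫ x, h x ∂(gaussianReal 0 1)) ∂μ := by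
      rw [integral_sub hhi (integrable_const _)]; simp
    rw [this]
    refine integral_congr_ae (ae_of_all _ fun ω => ?_)
    simp only
    rw [← Finset.sum_mul, ← hW, ← hst]
  rw [key, Finset.mul_sum, ← Finset.sum_add_distrib]
  refine (Finset.abs_sum_le_sum_abs _ _).trans (Finset.sum_le_sum fun i _ => ?_)
  exact st_local μ (ξ i) (η i) (τ i) W (hmeas i) (hηm i) (hτm i) hWm (hmean i) (i1 i) (i2 i)
    (hint1 i) (hint2 i) (hint3 i) (hint4 i) (hint0 i) hWi f f' df f'L f'c fb

lemma st_lip_int {Ω : Type*} [MeasurableSpace Ω] (ν : Measure Ω) [IsProbabilityMeasure ν]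
    (Y : Ω → ℝ) (k : ℝ → ℝ) (hk : LipschitzWith 1 k) (hYm : Measurable Y) (hY : Integrable Y ν) :
    Integrable (fun ω => k (Y ω)) ν := by
  refine ((integrable_const (|k 0|)).add hY.abs).mono'
    (hk.continuous.measurable.comp hYm).aestronglyMeasurable (ae_of_all _ fun ω => ?_)
  have h1 := st_lip_bound hk (Y ω) 0
  have := abs_sub_abs_le_abs_sub (k (Y ω)) (k 0)
  simp at h1 ⊢
  linarith

lemma st_close {Ω : Type*} [MeasurableSpace Ω] (ν : Measure Ω) [IsProbabilityMeasure ν]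
    (Y : Ω → ℝ) (h g : ℝ → ℝ) (hL : LipschitzWith 1 h) (gL : LipschitzWith 1 g)
    (hYm : Measurable Y) (hY : Integrable Y ν) {δ : ℝ} (hδ : ∀ x, |g x - h x| ≤ δ) :
    |(∫ ω, g (Y ω) ∂ν) - ∫ ω, h (Y ω) ∂ν| ≤ δ := by
  rw [← integral_sub (st_lip_int ν Y g gL hYm hY) (st_lip_int ν Y h hL hYm hY)]
  have := norm_integral_le_of_norm_le_const (μ := ν) (f := fun ω => g (Y ω) - h (Y ω)) (C := δ)
    (ae_of_all _ fun ω => hδ (Y ω))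
  simpa using this

/-- Lemma 1 (Stein bound under local dependence, Chen–Goldstein–Shao):
if each `ξ i` is independent of `(ξ j)_{j ∉ A i}` and `(ξ j)_{j ∈ A i}` is independent of
`(ξ j)_{j ∉ B i}`, the `ξ i` have mean zero and `W = ∑ ξ i` has variance one, then with
`η i = ∑_{j ∈ A i} ξ j` and `τ i = ∑_{j ∈ B i} ξ j`, the Wasserstein distance between `W`
and a standard normal `Z` satisfies
`d_W(W, Z) ≤ 2 ∑ᵢ (E|ξᵢ ηᵢ τᵢ| + |E(ξᵢ ηᵢ)| E|τᵢ|) + ∑ᵢ E|ξᵢ ηᵢ²|`. -/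
theorem wasserstein_bound_local_dependence
    {Ω : Type*} [MeasurableSpace Ω] (μ : Measure Ω) [IsProbabilityMeasure μ]
    (n : ℕ) (ξ : Fin n → Ω → ℝ)
    (hmeas : ∀ i, Measurable (ξ i))
    (hmean : ∀ i, ∫ ω, ξ i ω ∂μ = 0)
    (W : Ω → ℝ) (hW : ∀ ω, W ω = ∑ i, ξ i ω)
    (hvarW : variance W μ = 1)
    (A B : Fin n → Finset (Fin n))
    (hAB : ∀ i, A i ⊆ B i)
    -- (LD): ξ i is independent of (ξ j)_{j ∉ A i}
    (hLD1 : ∀ i, IndepFun (ξ i) (fun ω => fun j : {j : Fin n // j ∉ A i} => ξ j ω) μ)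
    -- (LD): (ξ j)_{j ∈ A i} is independent of (ξ j)_{j ∉ B i}
    (hLD2 : ∀ i, IndepFun (fun ω => fun j : {j : Fin n // j ∈ A i} => ξ j ω)
                          (fun ω => fun j : {j : Fin n // j ∉ B i} => ξ j ω) μ)
    (η τ : Fin n → Ω → ℝ)
    (hη : ∀ i ω, η i ω = ∑ j ∈ A i, ξ j ω)
    (hτ : ∀ i ω, τ i ω = ∑ j ∈ B i, ξ j ω)
    -- all expectations appearing in the bound are assumed finite
    (hint1 : ∀ i, Integrable (fun ω => ξ i ω * η i ω * τ i ω) μ)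
    (hint2 : ∀ i, Integrable (fun ω => ξ i ω * η i ω) μ)
    (hint3 : ∀ i, Integrable (τ i) μ)
    (hint4 : ∀ i, Integrable (fun ω => ξ i ω * (η i ω) ^ 2) μ)
    (hint0 : ∀ i, Integrable (ξ i) μ) :
    ∀ h : ℝ → ℝ, LipschitzWith 1 h →
      |(∫ ω, h (W ω) ∂μ) - ∫ x, h x ∂(gaussianReal 0 1)|
        ≤ 2 * (∑ i, ((∫ ω, |ξ i ω * η i ω * τ i ω| ∂μ)
                      + |∫ ω, ξ i ω * η i ω ∂μ| * ∫ ω, |τ i ω| ∂μ))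
          + ∑ i, ∫ ω, |ξ i ω * (η i ω) ^ 2| ∂μ := by
  intro h hL
  have hWm : Measurable W := by
    rw [show W = fun ω => ∑ i, ξ i ω from funext hW]; fun_prop
  have hWi : Integrable W μ := by
    rw [show W = fun ω => ∑ i, ξ i ω from funext hW]
    exact integrable_finsetSum _ fun i _ => hint0 i
  refine le_of_forall_pos_le_add fun ε hε => ?_
  obtain ⟨g, g', gL, gd, gb, gh⟩ := st_smooth hL (half_pos hε)
  have hm := st_main μ n ξ hmeas hmean W hW hvarW A B hLD1 hLD2 η τ hη hτ hint1 hint2 hint3 hint4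
    hint0 g g' gL gd gb
  have hid : Integrable (fun x : ℝ => x) (gaussianReal 0 1) :=
    memLp_one_iff_integrable.1 (memLp_id_gaussianReal 1)
  have c1 := st_close μ W h g hL gL hWm hWi gh
  have c2 := st_close (gaussianReal 0 1) (fun x => x) h g hL gL measurable_id hid gh
  rw [abs_le] at *
  constructor <;> linarith
end

section
/- Let ξ_1,…,ξ_n be real random variables with finite fourth moments, E[ξ_i] = 0 for all i, W = Σ_{i=1}^n ξ_i, and Var(W) = 1. Suppose that for each i ∈ {1,…,n} there exist sets A_i ⊂ B_i ⊂ {1,…,n} such that ξ_i is independent of the collection (ξ_j)_{j ∉ A_i} and the collection (ξ_j)_{j ∈ A_i} is independent of (ξ_j)_{j ∉ B_i}. Then for Z standard normal, d_W(W, Z) ≤ 2 Σ_{i=1}^n Σ_{j∈A_i} Σ_{k∈B_i} [E(ξ_i⁴) E(ξ_j⁴) E(ξ_k⁴)]^{1/4} + 2 Σ_{i=1}^n Σ_{j∈A_i} Σ_{k∈B_i} [E(ξ_i²) E(ξ_j²) E(ξ_k²)]^{1/2} + Σ_{i=1}^n |A_i| Σ_{j∈A_i} [E(ξ_i²) E(ξ_j⁴)]^{1/2}.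 -/
open MeasureTheory ProbabilityTheory Real

namespace SteinLD

noncomputable def p (x : ℝ) : ℝ := rexp (-x ^ 2 / 2)

lemma p_pos (x : ℝ) : 0 < p x := exp_pos _

lemma p_cont : Continuous p := by unfold p; fun_prop

lemma p_deriv (x : ℝ) : HasDerivAt p (-x * p x) x := by
  unfold p
  have h : HasDerivAt (fun y : ℝ => -y ^ 2 / 2) (-x) x := by
    have := ((hasDerivAt_pow 2 x).neg).div_const 2
    convert! this using 1
    simp; ring
  convert! h.exp using 1
  ring

lemma p_eq (x : ℝ) : p x = rexp (-(1 / 2) * x ^ 2) := by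
  unfold p; congr 1; ring

lemma int_p : Integrable p := by
  have := integrable_exp_neg_mul_sq (b := 1 / 2) (by norm_num)
  exact this.congr (Filter.Eventually.of_forall fun x => (p_eq x).symm)

lemma int_xp : Integrable (fun x => x * p x) := by
  have := integrable_mul_exp_neg_mul_sq (b := 1 / 2) (by norm_num)
  simpa only [p_eq] using this

lemma int_x2p : Integrable (fun x => x ^ 2 * p x) := by
  have := integrable_rpow_mul_exp_neg_mul_sq (b := 1 / 2) (by norm_num) (s := 2) (by norm_num)
  simpa only [p_eq, rpow_two] using this

lemma tend_p : Filter.Tendsto p (Filter.cocompact ℝ) (nhds 0) := by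
  have := tendsto_rpow_abs_mul_exp_neg_mul_sq_cocompact (a := 1 / 2) (by norm_num) 0
  simpa only [← p_eq, rpow_zero, one_mul] using this

lemma tend_xp : Filter.Tendsto (fun x => x * p x) (Filter.cocompact ℝ) (nhds 0) := by
  have := tendsto_rpow_abs_mul_exp_neg_mul_sq_cocompact (a := 1 / 2) (by norm_num) 1
  simp only [← p_eq, rpow_one] at this
  rw [tendsto_zero_iff_abs_tendsto_zero]
  refine this.congr fun x => ?_
  simp [abs_mul, abs_of_pos (p_pos x)]

lemma tend_G (w : ℝ) :
    Filter.Tendsto (fun x => (2 * w - x) * p x) (Filter.cocompact ℝ) (nhds 0) := by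
  have := (tend_p.const_mul (2 * w)).sub tend_xp
  simp only [mul_zero, sub_zero] at this
  exact this.congr fun x => by ring

lemma G_deriv (w x : ℝ) : HasDerivAt (fun x => (2 * w - x) * p x)
    (((x - w) ^ 2 - (1 + w ^ 2)) * p x) x := by
  have := ((hasDerivAt_id x).const_sub (2 * w)).mul (p_deriv x)
  convert! this using 1
  simp; ring

lemma int_sqp (w : ℝ) : Integrable (fun x => (x - w) ^ 2 * p x) := by
  have := (int_x2p.sub (int_xp.const_mul (2 * w))).add (int_p.const_mul (w ^ 2))
  refine this.congr (Filter.Eventually.of_forall fun x => ?_)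
  simp; ring

lemma int_G' (w : ℝ) : Integrable (fun x => ((x - w) ^ 2 - (1 + w ^ 2)) * p x) := by
  have := (int_sqp w).sub (int_p.const_mul (1 + w ^ 2))
  refine this.congr (Filter.Eventually.of_forall fun x => ?_)
  simp; ring

lemma mills_Ioi (w : ℝ) : w * p w ≤ (1 + w ^ 2) * ∫ x in Set.Ioi w, p x := by
  have h1 := integral_Ioi_of_hasDerivAt_of_tendsto' (a := w) (fun x _ => G_deriv w x)
    (int_G' w).integrableOn ((tend_G w).mono_left atTop_le_cocompact)
  have h2 : ∫ x in Set.Ioi w, ((x - w) ^ 2 - (1 + w ^ 2)) * p x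
      = (∫ x in Set.Ioi w, (x - w) ^ 2 * p x) - (1 + w ^ 2) * ∫ x in Set.Ioi w, p x := by
    rw [← integral_const_mul, ← integral_sub (int_sqp w).integrableOn
      (int_p.const_mul (1 + w ^ 2)).integrableOn]
    congr 1; ext x; ring
  have h3 : 0 ≤ ∫ x in Set.Ioi w, (x - w) ^ 2 * p x :=
    integral_nonneg fun x => mul_nonneg (sq_nonneg _) (p_pos x).le
  linarith

lemma mills_Iic (w : ℝ) : -(w * p w) ≤ (1 + w ^ 2) * ∫ x in Set.Iic w, p x := by
  have h1 := integral_Iic_of_hasDerivAt_of_tendsto' (a := w) (fun x _ => G_deriv w x)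
    (int_G' w).integrableOn ((tend_G w).mono_left atBot_le_cocompact)
  have h2 : ∫ x in Set.Iic w, ((x - w) ^ 2 - (1 + w ^ 2)) * p x
      = (∫ x in Set.Iic w, (x - w) ^ 2 * p x) - (1 + w ^ 2) * ∫ x in Set.Iic w, p x := by
    rw [← integral_const_mul, ← integral_sub (int_sqp w).integrableOn
      (int_p.const_mul (1 + w ^ 2)).integrableOn]
    congr 1; ext x; ring
  have h3 : 0 ≤ ∫ x in Set.Iic w, (x - w) ^ 2 * p x :=
    integral_nonneg fun x => mul_nonneg (sq_nonneg _) (p_pos x).le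
  linarith

lemma int_Iic_xp (w : ℝ) : ∫ x in Set.Iic w, x * p x = - p w := by
  have h1 := integral_Iic_of_hasDerivAt_of_tendsto' (a := w) (fun x _ => (p_deriv x).neg)
    (by simpa using int_xp.integrableOn) (by simpa using! tend_p.neg.mono_left atBot_le_cocompact)
  simpa using h1

lemma int_all_xp : ∫ x, x * p x = 0 := by
  have := integral_of_hasDerivAt_of_tendsto (fun x => (p_deriv x).neg)
    (by simpa using int_xp) (by simpa using! tend_p.neg.mono_left atBot_le_cocompact)
    (by simpa using! tend_p.neg.mono_left atTop_le_cocompact)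
  simpa using this

lemma mono_lemma (k : ℝ → ℝ) (hk : Monotone k) (hi : Integrable (fun x => k x * p x))
    (h0 : ∫ x, k x * p x = 0) (w : ℝ) :
    (1 + w ^ 2) * (∫ x in Set.Iic w, k x * p x) + w * p w * k w ≤ 0 := by
  have hsplit := intervalIntegral.integral_Iic_add_Ioi (b := w) hi.integrableOn hi.integrableOn
  rw [h0] at hsplit
  rcases le_total 0 (k w) with hc | hc
  · have h1 : k w * ∫ x in Set.Ioi w, p x ≤ ∫ x in Set.Ioi w, k x * p x := by
      rw [← integral_const_mul]
      refine setIntegral_mono_on (int_p.const_mul _).integrableOn hi.integrableOn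
        measurableSet_Ioi fun x hx => ?_
      exact mul_le_mul_of_nonneg_right (hk (le_of_lt hx)) (p_pos x).le
    have h2 := mul_le_mul_of_nonneg_left (mills_Ioi w) hc
    have h3 := mul_le_mul_of_nonneg_left h1 (by positivity : 0 ≤ 1 + w ^ 2)
    nlinarith
  · have h1 : ∫ x in Set.Iic w, k x * p x ≤ k w * ∫ x in Set.Iic w, p x := by
      rw [← integral_const_mul]
      refine setIntegral_mono_on hi.integrableOn (int_p.const_mul _).integrableOn
        measurableSet_Iic fun x hx => ?_
      exact mul_le_mul_of_nonneg_right (hk hx) (p_pos x).le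
    have h2 := mul_le_mul_of_nonpos_left (mills_Iic w) hc
    have h3 := mul_le_mul_of_nonneg_left h1 (by positivity : 0 ≤ 1 + w ^ 2)
    nlinarith

lemma lip_abs {h : ℝ → ℝ} (hh : LipschitzWith 1 h) (x y : ℝ) : |h x - h y| ≤ |x - y| := by
  have := hh.dist_le_mul x y
  simpa [Real.dist_eq] using this

lemma mono_pm {h : ℝ → ℝ} (hh : LipschitzWith 1 h) (m : ℝ) (s : ℝ) (hs : |s| ≤ 1) :
    Monotone (fun x => x + s * (h x - m)) := by
  intro x y hxy
  have h1 := lip_abs hh y x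
  rw [abs_of_nonneg (sub_nonneg.2 hxy)] at h1
  have h2 : |s * (h y - h x)| ≤ y - x := by
    rw [abs_mul]
    nlinarith [abs_nonneg s, abs_nonneg (h y - h x)]
  have := (abs_le.1 h2).1
  simp only
  nlinarith

lemma int_hp {h : ℝ → ℝ} (hh : LipschitzWith 1 h) (m : ℝ) :
    Integrable (fun x => (h x - m) * p x) := by
  have hb : Integrable (fun x => |h 0 - m| * p x + |x * p x|) :=
    (int_p.const_mul _).add int_xp.abs
  refine hb.mono' ((hh.continuous.sub continuous_const).mul p_cont).aestronglyMeasurable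
    (Filter.Eventually.of_forall fun x => ?_)
  have h1 := lip_abs hh x 0
  have h2 : |h x - m| ≤ |h 0 - m| + |x| := by
    have := abs_add_le (h x - h 0) (h 0 - m)
    simp only [sub_add_sub_cancel, sub_zero] at this h1
    linarith
  rw [Real.norm_eq_abs, abs_mul, abs_mul, abs_of_pos (p_pos x)]
  nlinarith [p_pos x]

lemma mean_zero {h : ℝ → ℝ} (hh : LipschitzWith 1 h) :
    ∫ x, (h x - ∫ y, h y ∂(gaussianReal 0 1)) * p x = 0 := by
  set m := ∫ y, h y ∂(gaussianReal 0 1) with hm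
  have hd : ∀ x, gaussianPDFReal 0 1 x = (√(2 * π))⁻¹ * p x := by
    intro x; simp [gaussianPDFReal, p]
  have e1 : ∫ x, h x ∂(gaussianReal 0 1) = (√(2 * π))⁻¹ * ∫ x, h x * p x := by
    rw [integral_gaussianReal_eq_integral_smul (by norm_num), ← integral_const_mul]
    congr 1; ext x; rw [hd, smul_eq_mul]; ring
  have e2 : 1 = (√(2 * π))⁻¹ * ∫ x, p x := by
    rw [← integral_gaussianPDFReal_eq_one 0 (v := 1) (by norm_num), ← integral_const_mul]
    congr 1; ext x; rw [hd]
  have e3 : ∫ x, (h x - m) * p x = (∫ x, h x * p x) - m * ∫ x, p x := by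
    rw [← integral_const_mul, ← integral_sub (by simpa using int_hp hh 0) (int_p.const_mul m)]
    congr 1; ext x; ring
  rw [e3]
  have hne : (√(2 * π))⁻¹ ≠ 0 := by positivity
  apply mul_left_cancel₀ hne
  rw [mul_sub, ← e1, mul_left_comm, ← e2, ← hm]; ring

/-- Stein solution. -/
lemma stein {h : ℝ → ℝ} (hh : LipschitzWith 1 h) : ∃ f f' : ℝ → ℝ,
    (∀ x, HasDerivAt f (f' x) x) ∧
    (∀ x, f' x - x * f x = h x - ∫ y, h y ∂(gaussianReal 0 1)) ∧
    (∀ x, |f x| ≤ 1) ∧ (∀ x y, |f' x - f' y| ≤ 2 * |x - y|) := by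
  have h0 := mean_zero hh
  set m := ∫ y, h y ∂(gaussianReal 0 1) with hm
  have hi := int_hp hh m
  have hc : Continuous (fun x => (h x - m) * p x) :=
    (hh.continuous.sub continuous_const).mul p_cont
  set J : ℝ → ℝ := fun w => ∫ x in Set.Iic w, (h x - m) * p x with hJ
  have hJd : ∀ w, HasDerivAt J ((h w - m) * p w) w := by
    intro w
    have : J = fun w => J 0 + ∫ x in (0 : ℝ)..w, (h x - m) * p x := by
      ext w
      have := intervalIntegral.integral_Iic_sub_Iic (a := 0) (b := w) hi.integrableOn
        hi.integrableOn
      simp only [hJ]; rw [← this]; ring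
    rw [this]
    exact (intervalIntegral.integral_hasDerivAt_right (hc.intervalIntegrable _ _)
      (hc.stronglyMeasurableAtFilter _ _) hc.continuousAt).const_add _
  set f : ℝ → ℝ := fun w => (p w)⁻¹ * J w with hf
  set f' : ℝ → ℝ := fun w => w * f w + (h w - m) with hf'
  have hfd : ∀ x, HasDerivAt f (f' x) x := by
    intro x
    have := ((p_deriv x).inv (p_pos x).ne').mul (hJd x)
    convert! this using 1
    have := (p_pos x).ne'
    simp only [hf', hf, Pi.inv_apply]
    field_simp
  have hJp : ∀ x, J x = p x * f x := by
    intro x; simp only [hf]; field_simp [(p_pos x).ne']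
  have key : ∀ s : ℝ, |s| ≤ 1 → ∀ w, s * (f w + w * f' w) ≤ 1 := by
    intro s hs w
    have hint : Integrable (fun x => (x + s * (h x - m)) * p x) := by
      refine (int_xp.add (hi.const_mul s)).congr (Filter.Eventually.of_forall fun x => ?_)
      simp; ring
    have hz : ∫ x, (x + s * (h x - m)) * p x = 0 := by
      have : ∫ x, (x + s * (h x - m)) * p x = (∫ x, x * p x) + s * ∫ x, (h x - m) * p x := by
        rw [← integral_const_mul, ← integral_add int_xp (hi.const_mul s)]
        congr 1; ext x; ring
      rw [this, int_all_xp, h0]; ring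
    have h1 := mono_lemma _ (mono_pm hh m s hs) hint hz w
    have h2 : ∫ x in Set.Iic w, (x + s * (h x - m)) * p x = - p w + s * J w := by
      rw [← int_Iic_xp, hJ]
      simp only
      rw [← integral_const_mul, ← integral_add int_xp.integrableOn (hi.const_mul s).integrableOn]
      congr 1; ext x; ring
    rw [h2, hJp] at h1
    have h3 : p w * (s * (f w + w * f' w) - 1) ≤ 0 := by
      simp only [hf']
      refine le_trans (le_of_eq ?_) h1
      ring
    have := nonpos_of_mul_nonpos_right h3 (p_pos w)
    linarith
  have hu : ∀ w, |f w + w * f' w| ≤ 1 := by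
    intro w
    rw [abs_le]
    have h1 := key 1 (by simp) w
    have h2 := key (-1) (by simp) w
    constructor <;> linarith
  have hwf : ∀ x y, |x * f x - y * f y| ≤ |x - y| := by
    intro x y
    have hd : ∀ w, HasDerivAt (fun x => x * f x) (f w + w * f' w) w := by
      intro w
      have := (hasDerivAt_id w).mul (hfd w)
      convert! this using 1
      simp
    have := Convex.norm_image_sub_le_of_norm_hasDerivWithin_le (s := Set.univ)
      (f := fun x => x * f x) (C := 1)
      (fun w _ => (hd w).hasDerivWithinAt) (fun w _ => hu w) convex_univ
      (Set.mem_univ y) (Set.mem_univ x)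
    simpa using this
  refine ⟨f, f', hfd, fun x => by simp only [hf']; ring, ?_, ?_⟩
  · have hcl : IsClosed {x : ℝ | |f x| ≤ 1} := by
      have : Continuous f := continuous_iff_continuousAt.2 fun x => (hfd x).continuousAt
      exact isClosed_le this.abs continuous_const
    have hd : Dense ({0}ᶜ : Set ℝ) := dense_compl_singleton 0
    intro x
    have hsub : ({0}ᶜ : Set ℝ) ⊆ {x : ℝ | |f x| ≤ 1} := by
      intro y hy
      have h1 := hwf y 0
      simp only [zero_mul, sub_zero, abs_mul] at h1
      have hy' : 0 < |y| := abs_pos.2 hy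
      show |f y| ≤ 1
      by_contra hcon
      push Not at hcon
      nlinarith
    have := closure_minimal hsub hcl
    exact this (hd x)
  · intro x y
    have h1 := hwf x y
    have h2 := lip_abs hh x y
    have : f' x - f' y = (x * f x - y * f y) + (h x - h y) := by simp only [hf']; ring
    rw [this]
    exact (abs_add_le _ _).trans (by linarith)

lemma tangent_le {F g : ℝ → ℝ} (hF : ∀ x, HasDerivAt F (g x) x) (hg : Monotone g) (a b : ℝ) :
    F a + g a * (b - a) ≤ F b := by
  have hcont : Continuous F := continuous_iff_continuousAt.2 fun x => (hF x).continuousAt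
  rcases lt_trichotomy a b with h | h | h
  · obtain ⟨c, hc, e⟩ := exists_hasDerivAt_eq_slope F g h hcont.continuousOn (fun x _ => hF x)
    rw [eq_div_iff (by linarith)] at e
    have := hg hc.1.le
    nlinarith
  · subst h; simp
  · obtain ⟨c, hc, e⟩ := exists_hasDerivAt_eq_slope F g h hcont.continuousOn (fun x _ => hF x)
    rw [eq_div_iff (by linarith)] at e
    have := hg hc.2.le
    nlinarith

lemma taylor {f f' : ℝ → ℝ} (hf : ∀ x, HasDerivAt f (f' x) x)
    (hl : ∀ x y, |f' x - f' y| ≤ 2 * |x - y|) (w y : ℝ) :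
    |f w - f (w - y) - y * f' w| ≤ y ^ 2 := by
  have hsq : ∀ x : ℝ, HasDerivAt (fun x : ℝ => x ^ 2) (2 * x) x := fun x => by
    simpa using hasDerivAt_pow 2 x
  have m1 : Monotone (fun x => 2 * x + f' x) := by
    intro x z hxz
    have := abs_le.1 (hl z x)
    rw [abs_of_nonneg (sub_nonneg.2 hxz)] at this
    simp only; linarith
  have m2 : Monotone (fun x => 2 * x - f' x) := by
    intro x z hxz
    have := abs_le.1 (hl z x)
    rw [abs_of_nonneg (sub_nonneg.2 hxz)] at this
    simp only; linarith
  have h1 := tangent_le (fun x => (hsq x).add (hf x)) m1 w (w - y)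
  have h2 := tangent_le (fun x => (hsq x).sub (hf x)) m2 w (w - y)
  simp at h1 h2
  rw [abs_le]
  constructor <;> nlinarith

end SteinLD

namespace SteinLD

variable {Ω : Type*} [MeasurableSpace Ω] {μ : Measure Ω} [IsProbabilityMeasure μ]

lemma cs {X Y : Ω → ℝ} (hX : MemLp X 2 μ) (hY : MemLp Y 2 μ) :
    ∫ ω, |X ω * Y ω| ∂μ ≤ √(∫ ω, X ω ^ 2 ∂μ) * √(∫ ω, Y ω ^ 2 ∂μ) := by
  have := integral_mul_le_Lp_mul_Lq_of_nonneg (μ := μ) (p := 2) (q := 2) (f := fun ω => |X ω|)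
    (g := fun ω => |Y ω|) HolderConjugate.two_two (Filter.Eventually.of_forall fun ω => abs_nonneg _)
    (Filter.Eventually.of_forall fun ω => abs_nonneg _) (by simpa using! hX.abs) (by simpa using! hY.abs)
  simp only [rpow_two, sq_abs, ← sqrt_eq_rpow] at this
  simpa only [abs_mul] using this

lemma f'_memLp {f' : ℝ → ℝ} (hl : ∀ x y, |f' x - f' y| ≤ 2 * |x - y|) (hc : Continuous f')
    {V : Ω → ℝ} (hV : MemLp V 2 μ) : MemLp (fun ω => f' (V ω)) 2 μ := by
  have hV' : MemLp (fun ω => 2 * |V ω|) 2 μ := MemLp.const_mul (f := fun ω => |V ω|) hV.abs 2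
  have hb : MemLp (fun ω => |f' 0| + 2 * |V ω|) 2 μ :=
    MemLp.add (f := fun _ => |f' 0|) (memLp_const _) hV'
  refine hb.mono (hc.comp_aestronglyMeasurable hV.aestronglyMeasurable)
    (Filter.Eventually.of_forall fun ω => ?_)
  have h1 := hl (V ω) 0
  have h2 := abs_sub_abs_le_abs_sub (f' (V ω)) (f' 0)
  rw [sub_zero] at h1
  rw [Real.norm_eq_abs, Real.norm_eq_abs]
  refine le_trans ?_ (le_abs_self _)
  linarith

lemma int_mul_f {f : ℝ → ℝ} (hf1 : ∀ x, |f x| ≤ 1) (hc : Continuous f)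
    {X V : Ω → ℝ} (hX : MemLp X 2 μ) (hV : MemLp V 2 μ) :
    Integrable (fun ω => X ω * f (V ω)) μ :=
  (hX.integrable one_le_two).mul_bdd (c := 1)
    (hc.comp_aestronglyMeasurable hV.aestronglyMeasurable)
    (Filter.Eventually.of_forall fun ω => hf1 _)

lemma step {f f' : ℝ → ℝ} (hf : ∀ x, HasDerivAt f (f' x) x) (hf1 : ∀ x, |f x| ≤ 1)
    (hl : ∀ x y, |f' x - f' y| ≤ 2 * |x - y|) (hc' : Continuous f')
    {X η τ W : Ω → ℝ} (hX : MemLp X 2 μ) (hη : MemLp η 2 μ) (hτ : MemLp τ 2 μ) (hW : MemLp W 2 μ)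
    (hXη : MemLp (fun ω => X ω * η ω) 2 μ)
    (e1 : ∫ ω, X ω * f (W ω - η ω) ∂μ = 0)
    (e2 : ∫ ω, (X ω * η ω) * f' (W ω - τ ω) ∂μ
      = (∫ ω, X ω * η ω ∂μ) * ∫ ω, f' (W ω - τ ω) ∂μ) :
    |(∫ ω, X ω * η ω ∂μ) * (∫ ω, f' (W ω) ∂μ) - ∫ ω, X ω * f (W ω) ∂μ|
      ≤ 2 * ∫ ω, |X ω * η ω * τ ω| ∂μ + 2 * ((∫ ω, |X ω * η ω| ∂μ) * ∫ ω, |τ ω| ∂μ)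
        + ∫ ω, |X ω * η ω * η ω| ∂μ := by
  have hc : Continuous f := continuous_iff_continuousAt.2 fun x => (hf x).continuousAt
  have i1 := int_mul_f hf1 hc hX hW
  have i2 := int_mul_f hf1 hc hX (hW.sub hη)
  have m1 := f'_memLp hl hc' hW
  have m2 := f'_memLp hl hc' (hW.sub hτ)
  have i3 : Integrable (fun ω => (X ω * η ω) * f' (W ω)) μ := hXη.integrable_mul m1
  have i4 : Integrable (fun ω => (X ω * η ω) * f' (W ω - τ ω)) μ := hXη.integrable_mul m2
  have i5 : Integrable (fun ω => X ω * η ω * τ ω) μ := hXη.integrable_mul hτ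
  have i6 : Integrable (fun ω => X ω * η ω * η ω) μ := hXη.integrable_mul hη
  have j1 := m1.integrable one_le_two
  have j2 := m2.integrable one_le_two
  have jτ := hτ.integrable one_le_two
  have E : (∫ ω, X ω * η ω ∂μ) * (∫ ω, f' (W ω) ∂μ) - ∫ ω, X ω * f (W ω) ∂μ
      = (∫ ω, X ω * η ω ∂μ) * (∫ ω, (f' (W ω) - f' (W ω - τ ω)) ∂μ)
        - (∫ ω, ((X ω * η ω) * f' (W ω) - (X ω * η ω) * f' (W ω - τ ω)) ∂μ)
        - ∫ ω, (X ω * f (W ω) - X ω * f (W ω - η ω) - (X ω * η ω) * f' (W ω)) ∂μ := by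
    have a1 := integral_sub j1 j2
    have a2 := integral_sub i3 i4
    have a3 := integral_sub (i1.sub i2) i3
    have a4 := integral_sub i1 i2
    simp only [Pi.sub_apply] at a1 a2 a3 a4
    rw [a1, a2, a3, a4, e1, e2]
    ring
  rw [E]
  have b1 : |∫ ω, (f' (W ω) - f' (W ω - τ ω)) ∂μ| ≤ 2 * ∫ ω, |τ ω| ∂μ := by
    rw [← integral_const_mul]
    refine abs_integral_le_integral_abs.trans (integral_mono (j1.sub j2).abs (jτ.abs.const_mul 2)
      fun ω => ?_)
    simpa using hl (W ω) (W ω - τ ω)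
  have b2 : |∫ ω, ((X ω * η ω) * f' (W ω) - (X ω * η ω) * f' (W ω - τ ω)) ∂μ|
      ≤ 2 * ∫ ω, |X ω * η ω * τ ω| ∂μ := by
    rw [← integral_const_mul]
    refine abs_integral_le_integral_abs.trans (integral_mono (i3.sub i4).abs (i5.abs.const_mul 2)
      fun ω => ?_)
    have := hl (W ω) (W ω - τ ω)
    simp only [sub_sub_cancel] at this
    simp only
    rw [← mul_sub, abs_mul, abs_mul (X ω * η ω) (τ ω)]
    nlinarith [abs_nonneg (X ω * η ω)]
  have b3 : |∫ ω, (X ω * f (W ω) - X ω * f (W ω - η ω) - (X ω * η ω) * f' (W ω)) ∂μ|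
      ≤ ∫ ω, |X ω * η ω * η ω| ∂μ := by
    refine abs_integral_le_integral_abs.trans (integral_mono ((i1.sub i2).sub i3).abs i6.abs
      fun ω => ?_)
    have := taylor hf hl (W ω) (η ω)
    simp only
    rw [show X ω * f (W ω) - X ω * f (W ω - η ω) - (X ω * η ω) * f' (W ω)
      = X ω * (f (W ω) - f (W ω - η ω) - η ω * f' (W ω)) by ring, abs_mul,
      show X ω * η ω * η ω = X ω * η ω ^ 2 by ring, abs_mul, abs_of_nonneg (sq_nonneg (η ω))]
    exact mul_le_mul_of_nonneg_left this (abs_nonneg _)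
  have b4 : |∫ ω, X ω * η ω ∂μ| ≤ ∫ ω, |X ω * η ω| ∂μ := abs_integral_le_integral_abs
  have b5 := mul_le_mul b4 b1 (abs_nonneg _) ((abs_nonneg _).trans b4)
  rw [← abs_mul] at b5
  have t1 := abs_sub ((∫ ω, X ω * η ω ∂μ) * (∫ ω, (f' (W ω) - f' (W ω - τ ω)) ∂μ)
        - (∫ ω, ((X ω * η ω) * f' (W ω) - (X ω * η ω) * f' (W ω - τ ω)) ∂μ))
        (∫ ω, (X ω * f (W ω) - X ω * f (W ω - η ω) - (X ω * η ω) * f' (W ω)) ∂μ)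
  have t2 := abs_sub ((∫ ω, X ω * η ω ∂μ) * (∫ ω, (f' (W ω) - f' (W ω - τ ω)) ∂μ))
        (∫ ω, ((X ω * η ω) * f' (W ω) - (X ω * η ω) * f' (W ω - τ ω)) ∂μ)
  linarith

lemma memLp_of4 {X : Ω → ℝ} (hX : Measurable X) (h4 : Integrable (fun ω => X ω ^ 4) μ) :
    MemLp X 2 μ := by
  rw [memLp_two_iff_integrable_sq hX.aestronglyMeasurable]
  refine ((integrable_const (1 : ℝ)).add h4).mono' (hX.pow_const 2).aestronglyMeasurable
    (Filter.Eventually.of_forall fun ω => ?_)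
  simp only [Pi.add_apply]
  rw [Real.norm_eq_abs, abs_of_nonneg (sq_nonneg _)]
  nlinarith [sq_nonneg (X ω ^ 2 - 1), sq_nonneg (X ω)]

lemma memLp_sq {X : Ω → ℝ} (hX : Measurable X) (h4 : Integrable (fun ω => X ω ^ 4) μ) :
    MemLp (fun ω => X ω ^ 2) 2 μ := by
  rw [memLp_two_iff_integrable_sq (hX.pow_const 2).aestronglyMeasurable]
  simpa only [← pow_mul] using h4

lemma memLp_mul {X Y : Ω → ℝ} (hX : Measurable X) (h4 : Integrable (fun ω => X ω ^ 4) μ)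
    (hY : Measurable Y) (h4' : Integrable (fun ω => Y ω ^ 4) μ) :
    MemLp (fun ω => X ω * Y ω) 2 μ := by
  refine (memLp_two_iff_integrable_sq (hX.mul hY).aestronglyMeasurable).2 ?_
  refine (h4.add h4').mono' ((hX.mul hY).pow_const 2).aestronglyMeasurable
    (Filter.Eventually.of_forall fun ω => ?_)
  simp only [Pi.add_apply, Pi.mul_apply]
  rw [Real.norm_eq_abs, abs_of_nonneg (sq_nonneg _)]
  nlinarith [sq_nonneg (X ω ^ 2 - Y ω ^ 2), sq_nonneg (X ω ^ 2), sq_nonneg (Y ω ^ 2)]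

lemma mom1 {X Y Z : Ω → ℝ} (hX : Measurable X) (hX4 : Integrable (fun ω => X ω ^ 4) μ)
    (hY : Measurable Y) (hY4 : Integrable (fun ω => Y ω ^ 4) μ)
    (hZ : Measurable Z) (hZ4 : Integrable (fun ω => Z ω ^ 4) μ) :
    ∫ ω, |X ω * Y ω * Z ω| ∂μ ≤ ((∫ ω, X ω ^ 4 ∂μ) * (∫ ω, Y ω ^ 4 ∂μ) * (∫ ω, Z ω ^ 4 ∂μ))
                ^ ((1 : ℝ) / 4) := by
  have h1 := cs (memLp_mul hX hX4 hY hY4) (memLp_of4 hZ hZ4)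
  have h2 := cs (memLp_sq hX hX4) (memLp_sq hY hY4)
  have h3 := cs (memLp_sq hZ hZ4) (memLp_const (1 : ℝ) (μ := μ))
  have q : ∀ x : ℝ, |x ^ 2| = x ^ 2 := fun x => abs_of_nonneg (sq_nonneg x)
  simp only [← mul_pow, q, mul_one, ← pow_mul, integral_const, probReal_univ, one_pow,
    smul_eq_mul, sqrt_one, Nat.reduceMul] at h2 h3
  have nn : ∀ V : Ω → ℝ, 0 ≤ ∫ ω, V ω ^ 4 ∂μ := fun V =>
    integral_nonneg fun ω => (by positivity)
  have e : ((∫ ω, X ω ^ 4 ∂μ) * (∫ ω, Y ω ^ 4 ∂μ) * (∫ ω, Z ω ^ 4 ∂μ)) ^ ((1 : ℝ) / 4)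
      = √(√(∫ ω, X ω ^ 4 ∂μ) * √(∫ ω, Y ω ^ 4 ∂μ)) * √√(∫ ω, Z ω ^ 4 ∂μ) := by
    rw [← sqrt_mul (nn X), ← sqrt_mul (by positivity), ← sqrt_mul (mul_nonneg (nn X) (nn Y)),
      sqrt_eq_rpow, sqrt_eq_rpow, ← rpow_mul (mul_nonneg (mul_nonneg (nn X) (nn Y)) (nn Z))]
    norm_num
  rw [e]
  refine h1.trans ?_
  gcongr

lemma mom2 {X Y Z : Ω → ℝ} (hX : MemLp X 2 μ) (hY : MemLp Y 2 μ) (hZ : MemLp Z 2 μ) :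
    (∫ ω, |X ω * Y ω| ∂μ) * (∫ ω, |Z ω| ∂μ)
      ≤ ((∫ ω, X ω ^ 2 ∂μ) * (∫ ω, Y ω ^ 2 ∂μ) * (∫ ω, Z ω ^ 2 ∂μ)) ^ ((1 : ℝ) / 2) := by
  have h1 := cs hX hY
  have h2 := cs hZ (memLp_const (1 : ℝ) (μ := μ))
  simp only [mul_one, integral_const, probReal_univ, one_pow,
    smul_eq_mul, sqrt_one] at h2
  have nn : ∀ V : Ω → ℝ, 0 ≤ ∫ ω, V ω ^ 2 ∂μ := fun V =>
    integral_nonneg fun ω => (by positivity)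
  rw [← sqrt_eq_rpow, sqrt_mul (mul_nonneg (nn X) (nn Y)), sqrt_mul (nn X)]
  exact mul_le_mul h1 h2 (integral_nonneg fun ω => abs_nonneg _) (by positivity)

lemma mom3 {X Y : Ω → ℝ} (hX : MemLp X 2 μ)
    (hY : Measurable Y) (hY4 : Integrable (fun ω => Y ω ^ 4) μ) :
    (∫ ω, |X ω * Y ω ^ 2| ∂μ)
      ≤ ((∫ ω, X ω ^ 2 ∂μ) * (∫ ω, Y ω ^ 4 ∂μ)) ^ ((1 : ℝ) / 2) := by
  have h1 := cs hX (memLp_sq hY hY4)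
  simp only [← pow_mul, Nat.reduceMul] at h1
  rw [← sqrt_eq_rpow, sqrt_mul (integral_nonneg fun ω => by positivity)]
  exact h1

end SteinLD

/-- Stein-type bound under local dependence, with the moments Hölderized:
`d_W(W,Z) ≤ 2 ∑ᵢ ∑_{j∈Aᵢ} ∑_{k∈Bᵢ} [E ξᵢ⁴ E ξⱼ⁴ E ξₖ⁴]^{1/4}
  + 2 ∑ᵢ ∑_{j∈Aᵢ} ∑_{k∈Bᵢ} [E ξᵢ² E ξⱼ² E ξₖ²]^{1/2}
  + ∑ᵢ |Aᵢ| ∑_{j∈Aᵢ} [E ξᵢ² E ξⱼ⁴]^{1/2}`. -/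
theorem wasserstein_bound_local_dependence_moments
    {Ω : Type*} [MeasurableSpace Ω] (μ : Measure Ω) [IsProbabilityMeasure μ]
    (n : ℕ) (ξ : Fin n → Ω → ℝ)
    (hmeas : ∀ i, Measurable (ξ i))
    (hmom4 : ∀ i, Integrable (fun ω => (ξ i ω) ^ 4) μ)
    (hmean : ∀ i, ∫ ω, ξ i ω ∂μ = 0)
    (W : Ω → ℝ) (hW : ∀ ω, W ω = ∑ i, ξ i ω)
    (hvarW : variance W μ = 1)
    (A B : Fin n → Finset (Fin n))
    (hAB : ∀ i, A i ⊆ B i)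
    -- ξ i is independent of (ξ j)_{j ∉ A i}
    (hLD1 : ∀ i, IndepFun (ξ i) (fun ω => fun j : {j : Fin n // j ∉ A i} => ξ j ω) μ)
    -- (ξ j)_{j ∈ A i} is independent of (ξ j)_{j ∉ B i}
    (hLD2 : ∀ i, IndepFun (fun ω => fun j : {j : Fin n // j ∈ A i} => ξ j ω)
                          (fun ω => fun j : {j : Fin n // j ∉ B i} => ξ j ω) μ) :
    ∀ h : ℝ → ℝ, LipschitzWith 1 h →
      |(∫ ω, h (W ω) ∂μ) - ∫ x, h x ∂(gaussianReal 0 1)|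
        ≤ 2 * ∑ i, ∑ j ∈ A i, ∑ k ∈ B i,
              ((∫ ω, (ξ i ω) ^ 4 ∂μ) * (∫ ω, (ξ j ω) ^ 4 ∂μ) * (∫ ω, (ξ k ω) ^ 4 ∂μ))
                ^ ((1 : ℝ) / 4)
          + 2 * ∑ i, ∑ j ∈ A i, ∑ k ∈ B i,
              ((∫ ω, (ξ i ω) ^ 2 ∂μ) * (∫ ω, (ξ j ω) ^ 2 ∂μ) * (∫ ω, (ξ k ω) ^ 2 ∂μ))
                ^ ((1 : ℝ) / 2)
          + ∑ i, ((A i).card : ℝ) * ∑ j ∈ A i,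
              ((∫ ω, (ξ i ω) ^ 2 ∂μ) * (∫ ω, (ξ j ω) ^ 4 ∂μ)) ^ ((1 : ℝ) / 2) := by
  intro h hh
  obtain ⟨f, f', hfd, hst, hf1, hl⟩ := SteinLD.stein hh
  have hc : Continuous f := continuous_iff_continuousAt.2 fun x => (hfd x).continuousAt
  have hc' : Continuous f' := by
    have : LipschitzWith 2 f' := LipschitzWith.of_dist_le_mul fun x y => by
      simpa [Real.dist_eq] using hl x y
    exact this.continuous
  have hL2 : ∀ i, MemLp (ξ i) 2 μ := fun i => SteinLD.memLp_of4 (hmeas i) (hmom4 i)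
  have hLL : ∀ i j, MemLp (fun ω => ξ i ω * ξ j ω) 2 μ := fun i j =>
    SteinLD.memLp_mul (hmeas i) (hmom4 i) (hmeas j) (hmom4 j)
  have hsum : ∀ S : Finset (Fin n), MemLp (fun ω => ∑ j ∈ S, ξ j ω) 2 μ := fun S =>
    memLp_finsetSum S fun j _ => hL2 j
  have hsumm : ∀ S : Finset (Fin n), Measurable (fun ω => ∑ j ∈ S, ξ j ω) := fun S =>
    Finset.measurable_sum S fun j _ => hmeas j
  have hWe : W = fun ω => ∑ i, ξ i ω := funext hW
  have hWL : MemLp W 2 μ := by rw [hWe]; exact hsum _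
  have hsub : ∀ (S : Finset (Fin n)) ω,
      W ω - ∑ j ∈ S, ξ j ω = ∑ j : {j : Fin n // j ∉ S}, ξ j ω := by
    intro S ω
    rw [hW, ← Finset.sum_add_sum_compl S, add_sub_cancel_left]
    exact Finset.sum_subtype Sᶜ (fun x => Finset.mem_compl) _
  have hXη : ∀ i, MemLp (fun ω => ξ i ω * ∑ j ∈ A i, ξ j ω) 2 μ := by
    intro i
    simp only [Finset.mul_sum]
    exact memLp_finsetSum _ fun j _ => hLL i j
  -- first independence
  have ind1 : ∀ (g : ℝ → ℝ), Continuous g → ∀ i,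
      ∫ ω, ξ i ω * g (W ω - ∑ j ∈ A i, ξ j ω) ∂μ = 0 := by
    intro g hg i
    have hI := (hLD1 i).comp (φ := id) (ψ := fun v => g (∑ j, v j)) measurable_id
      (hg.measurable.comp (Finset.measurable_sum _ fun j _ => measurable_pi_apply j))
    have := hI.integral_mul_eq_mul_integral (hmeas i).aestronglyMeasurable
      (hg.measurable.comp (Finset.measurable_sum Finset.univ
        fun (j : {j : Fin n // j ∉ A i}) _ => hmeas j)).aestronglyMeasurable
    simp only [hsub]
    refine this.trans ?_
    simp [hmean i]
  -- degenerate case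
  have hdeg : ∀ i, i ∉ A i → ξ i =ᵐ[μ] 0 := by
    intro i hi
    have hm : Measurable (fun v : {j : Fin n // j ∉ A i} → ℝ => v ⟨i, hi⟩) :=
      measurable_pi_apply _
    have hI := (hLD1 i).comp (φ := id) measurable_id hm
    have := hI.integral_mul_eq_mul_integral (hmeas i).aestronglyMeasurable
      (hmeas i).aestronglyMeasurable
    have h0 : ∫ ω, ξ i ω ^ 2 ∂μ = 0 := by
      have e : ∫ ω, ξ i ω ^ 2 ∂μ = ∫ ω, ξ i ω * ξ i ω ∂μ := by simp only [pow_two]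
      rw [e]
      refine this.trans ?_
      simp [hmean i]
    rw [integral_eq_zero_iff_of_nonneg (fun ω => sq_nonneg _) (hL2 i).integrable_sq] at h0
    filter_upwards [h0] with ω hω
    simpa using hω
  have ind2 : ∀ i, ∫ ω, (ξ i ω * ∑ j ∈ A i, ξ j ω) * f' (W ω - ∑ k ∈ B i, ξ k ω) ∂μ
      = (∫ ω, ξ i ω * ∑ j ∈ A i, ξ j ω ∂μ) * ∫ ω, f' (W ω - ∑ k ∈ B i, ξ k ω) ∂μ := by
    intro i
    by_cases hi : i ∈ A i
    · have hm : Measurable (fun v : {j : Fin n // j ∈ A i} → ℝ => v ⟨i, hi⟩ * ∑ j, v j) :=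
        (measurable_pi_apply _).mul (Finset.measurable_sum _ fun j _ => measurable_pi_apply j)
      have hI := (hLD2 i).comp (ψ := fun v => f' (∑ j, v j)) hm
        (hc'.measurable.comp (Finset.measurable_sum _ fun j _ => measurable_pi_apply j))
      have := hI.integral_mul_eq_mul_integral
        ((hmeas i).mul (Finset.measurable_sum Finset.univ
          fun (j : {j : Fin n // j ∈ A i}) _ => hmeas j)).aestronglyMeasurable
        (hc'.measurable.comp (Finset.measurable_sum Finset.univ
          fun (j : {j : Fin n // j ∉ B i}) _ => hmeas j)).aestronglyMeasurable
      have hs : ∀ ω, ∑ j ∈ A i, ξ j ω = ∑ j : {j : Fin n // j ∈ A i}, ξ j ω := fun ω =>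
        Finset.sum_subtype (A i) (fun x => Iff.rfl) _
      simp only [hsub, hs]
      exact this
    · have h0 := hdeg i hi
      have z1 : ∫ ω, (ξ i ω * ∑ j ∈ A i, ξ j ω) * f' (W ω - ∑ k ∈ B i, ξ k ω) ∂μ = 0 := by
        refine integral_eq_zero_of_ae ?_
        filter_upwards [h0] with ω hω
        simp [hω]
      have z2 : ∫ ω, ξ i ω * ∑ j ∈ A i, ξ j ω ∂μ = 0 := by
        refine integral_eq_zero_of_ae ?_
        filter_upwards [h0] with ω hω
        simp [hω]
      rw [z1, z2, zero_mul]
  -- variance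
  have hWmean : ∫ ω, W ω ∂μ = 0 := by
    simp only [hW]
    rw [integral_finsetSum _ fun i _ => (hL2 i).integrable one_le_two]
    simp [hmean]
  have hone : ∑ i, ∫ ω, ξ i ω * ∑ j ∈ A i, ξ j ω ∂μ = 1 := by
    rw [variance_of_integral_eq_zero hWL.aestronglyMeasurable.aemeasurable hWmean] at hvarW
    have e : ∀ ω, W ω ^ 2 = ∑ i, (ξ i ω * W ω) := by
      intro ω; rw [← Finset.sum_mul, ← hW]; ring
    simp only [e] at hvarW
    have ib : ∀ i, Integrable (fun ω => ξ i ω * W ω) μ := fun i => (hL2 i).integrable_mul hWL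
    rw [integral_finsetSum _ fun i _ => ib i] at hvarW
    rw [← hvarW]
    refine Finset.sum_congr rfl fun i _ => ?_
    have h1 := ind1 id continuous_id i
    simp only [id, mul_sub] at h1
    have ia : Integrable (fun ω => ξ i ω * W ω) μ := (hL2 i).integrable_mul hWL
    rw [integral_sub ia ((hXη i).integrable one_le_two)] at h1
    linarith
  -- assemble
  have jf' := (SteinLD.f'_memLp hl hc' hWL).integrable one_le_two
  have jWf := fun i => SteinLD.int_mul_f hf1 hc (hL2 i) hWL
  have hmain : (∫ ω, h (W ω) ∂μ) - ∫ x, h x ∂(gaussianReal 0 1)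
      = ∑ i, ((∫ ω, ξ i ω * ∑ j ∈ A i, ξ j ω ∂μ) * (∫ ω, f' (W ω) ∂μ)
          - ∫ ω, ξ i ω * f (W ω) ∂μ) := by
    have jW : Integrable (fun ω => ∑ i, ξ i ω * f (W ω)) μ :=
      integrable_finsetSum _ fun i _ => jWf i
    have e : ∀ ω, h (W ω)
        = (f' (W ω) - ∑ i, ξ i ω * f (W ω)) + ∫ x, h x ∂(gaussianReal 0 1) := by
      intro ω
      rw [← Finset.sum_mul, ← hW]
      have := hst (W ω)
      linarith
    have e2 : ∫ ω, h (W ω) ∂μ = ((∫ ω, f' (W ω) ∂μ) - ∑ i, ∫ ω, ξ i ω * f (W ω) ∂μ)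
        + ∫ x, h x ∂(gaussianReal 0 1) := by
      have jS : Integrable (fun ω => f' (W ω) - ∑ i, ξ i ω * f (W ω)) μ := jf'.sub jW
      rw [integral_congr_ae (Filter.Eventually.of_forall e),
        integral_add jS (integrable_const _), integral_sub jf' jW,
        integral_finsetSum _ fun i _ => jWf i]
      simp
    rw [e2, Finset.sum_sub_distrib, ← Finset.sum_mul, hone]
    ring
  rw [hmain]
  refine (Finset.abs_sum_le_sum_abs _ _).trans ?_
  rw [Finset.mul_sum, Finset.mul_sum, ← Finset.sum_add_distrib, ← Finset.sum_add_distrib]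
  refine Finset.sum_le_sum fun i _ => ?_
  refine (SteinLD.step hfd hf1 hl hc' (hL2 i) (hsum (A i)) (hsum (B i)) hWL (hXη i)
    (ind1 f hc i) (ind2 i)).trans ?_
  have i3 : ∀ j k, Integrable (fun ω => ξ i ω * ξ j ω * ξ k ω) μ := fun j k =>
    (hLL i j).integrable_mul (hL2 k)
  have c1 : ∫ ω, |ξ i ω * (∑ j ∈ A i, ξ j ω) * ∑ k ∈ B i, ξ k ω| ∂μ
      ≤ ∑ j ∈ A i, ∑ k ∈ B i,
        ((∫ ω, (ξ i ω) ^ 4 ∂μ) * (∫ ω, (ξ j ω) ^ 4 ∂μ) * (∫ ω, (ξ k ω) ^ 4 ∂μ))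
          ^ ((1 : ℝ) / 4) := by
    have b : ∫ ω, |ξ i ω * (∑ j ∈ A i, ξ j ω) * ∑ k ∈ B i, ξ k ω| ∂μ
        ≤ ∫ ω, ∑ j ∈ A i, ∑ k ∈ B i, |ξ i ω * ξ j ω * ξ k ω| ∂μ := by
      refine integral_mono ((hXη i).integrable_mul (hsum (B i))).abs
        (integrable_finsetSum _ fun j _ => integrable_finsetSum _ fun k _ => (i3 j k).abs)
        fun ω => ?_
      simp only
      rw [Finset.mul_sum (A i), Finset.sum_mul_sum]
      refine (Finset.abs_sum_le_sum_abs _ _).trans (Finset.sum_le_sum fun j _ => ?_)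
      exact Finset.abs_sum_le_sum_abs _ _
    refine b.trans ?_
    rw [integral_finsetSum _ fun j _ => integrable_finsetSum _ fun k _ => (i3 j k).abs]
    refine Finset.sum_le_sum fun j _ => ?_
    rw [integral_finsetSum _ fun k _ => (i3 j k).abs]
    refine Finset.sum_le_sum fun k _ => ?_
    exact SteinLD.mom1 (hmeas i) (hmom4 i) (hmeas j) (hmom4 j) (hmeas k) (hmom4 k)
  have c2 : (∫ ω, |ξ i ω * ∑ j ∈ A i, ξ j ω| ∂μ) * (∫ ω, |∑ k ∈ B i, ξ k ω| ∂μ)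
      ≤ ∑ j ∈ A i, ∑ k ∈ B i,
        ((∫ ω, (ξ i ω) ^ 2 ∂μ) * (∫ ω, (ξ j ω) ^ 2 ∂μ) * (∫ ω, (ξ k ω) ^ 2 ∂μ))
          ^ ((1 : ℝ) / 2) := by
    have i2 : ∀ j, Integrable (fun ω => |ξ i ω * ξ j ω|) μ := fun j =>
      ((hLL i j).integrable one_le_two).abs
    have i1 : ∀ k, Integrable (fun ω => |ξ k ω|) μ := fun k =>
      ((hL2 k).integrable one_le_two).abs
    have b1 : ∫ ω, |ξ i ω * ∑ j ∈ A i, ξ j ω| ∂μ ≤ ∑ j ∈ A i, ∫ ω, |ξ i ω * ξ j ω| ∂μ := by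
      rw [← integral_finsetSum _ fun j _ => i2 j]
      refine integral_mono ((hXη i).integrable one_le_two).abs
        (integrable_finsetSum _ fun j _ => i2 j) fun ω => ?_
      simp only
      rw [Finset.mul_sum]
      exact Finset.abs_sum_le_sum_abs _ _
    have b2 : ∫ ω, |∑ k ∈ B i, ξ k ω| ∂μ ≤ ∑ k ∈ B i, ∫ ω, |ξ k ω| ∂μ := by
      rw [← integral_finsetSum _ fun k _ => i1 k]
      exact integral_mono ((hsum (B i)).integrable one_le_two).abs
        (integrable_finsetSum _ fun k _ => i1 k) fun ω => Finset.abs_sum_le_sum_abs _ _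
    refine (mul_le_mul b1 b2 (integral_nonneg fun ω => abs_nonneg _)
      (Finset.sum_nonneg fun j _ => integral_nonneg fun ω => abs_nonneg _)).trans ?_
    rw [Finset.sum_mul_sum]
    exact Finset.sum_le_sum fun j _ => Finset.sum_le_sum fun k _ =>
      SteinLD.mom2 (hL2 i) (hL2 j) (hL2 k)
  have c3 : ∫ ω, |ξ i ω * (∑ j ∈ A i, ξ j ω) * ∑ j ∈ A i, ξ j ω| ∂μ
      ≤ ((A i).card : ℝ) * ∑ j ∈ A i,
        ((∫ ω, (ξ i ω) ^ 2 ∂μ) * (∫ ω, (ξ j ω) ^ 4 ∂μ)) ^ ((1 : ℝ) / 2) := by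
    have i2 : ∀ j, Integrable (fun ω => |ξ i ω * ξ j ω ^ 2|) μ := fun j =>
      ((hL2 i).integrable_mul (SteinLD.memLp_sq (hmeas j) (hmom4 j))).abs
    have b : ∫ ω, |ξ i ω * (∑ j ∈ A i, ξ j ω) * ∑ j ∈ A i, ξ j ω| ∂μ
        ≤ ∫ ω, ((A i).card : ℝ) * ∑ j ∈ A i, |ξ i ω * ξ j ω ^ 2| ∂μ := by
      refine integral_mono ((hXη i).integrable_mul (hsum (A i))).abs
        ((integrable_finsetSum _ fun j _ => i2 j).const_mul _) fun ω => ?_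
      simp only
      have := sq_sum_le_card_mul_sum_sq (s := A i) (f := fun j => ξ j ω)
      rw [mul_assoc, ← pow_two, abs_mul, abs_of_nonneg (sq_nonneg (∑ j ∈ A i, ξ j ω))]
      refine (mul_le_mul_of_nonneg_left this (abs_nonneg _)).trans (le_of_eq ?_)
      simp only [abs_mul, ← Finset.mul_sum, abs_pow, sq_abs]
      ring
    refine b.trans ?_
    rw [integral_const_mul, integral_finsetSum _ fun j _ => i2 j]
    refine mul_le_mul_of_nonneg_left (Finset.sum_le_sum fun j _ => ?_) (Nat.cast_nonneg _)
    exact SteinLD.mom3 (hL2 i) (hmeas j) (hmom4 j)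
  linarith
end

section
/- Fix k ∈ ℤ⁺, σ > 0, n ≥ 2, and s = (s_1,…,s_n) ∈ ℝⁿ. Define ℓ : ℝ → ℝ by ℓ(θ) = −(s_1 − (k+1)θ)² / (2(k+1)σ²) − ((k+1)/(2k(k+2)σ²)) Σ_{i=2}^n ( s_i − ( (k+1)θ + (s_{i−1} − (k+1)θ)/(k+1) ) )². Then ℓ has derivative ℓ'(θ) = (1/((k+2)σ²)) ( k Σ_{i=1}^n s_i + s_1 + s_n − (k+1)(nk+2)θ ), and ℓ attains its unique global maximum at θ̂ = (k Σ_{i=1}^n s_i + s_1 + s_n) / ((nk+2)(k+1)). -/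
open Finset Real

lemma sum_aux (K θ : ℝ) (hK : K + 1 ≠ 0) (s : ℕ → ℝ) (n : ℕ) (hn : 1 ≤ n) :
    ∑ i ∈ Finset.Icc 2 n, (s i - ((K + 1) * θ + (s (i - 1) - (K + 1) * θ) / (K + 1))) ^ 2
    = ∑ i ∈ Finset.Icc 2 n, (s i - s (i - 1) / (K + 1)) ^ 2
      - 2 * K * θ * (K * ∑ i ∈ Finset.Icc 1 n, s i + s n - (K + 1) * s 1) / (K + 1)
      + ((n : ℝ) - 1) * K ^ 2 * θ ^ 2 := by
  induction n, hn using Nat.le_induction with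
  | base => simp; left; right; ring
  | succ m hm ih =>
    rw [Finset.sum_Icc_succ_top (by omega), Finset.sum_Icc_succ_top (by omega),
      Finset.sum_Icc_succ_top (by omega), ih, Nat.add_sub_cancel]
    generalize ∑ i ∈ Finset.Icc 2 m, (s i - s (i - 1) / (K + 1)) ^ 2 = T
    push_cast
    field_simp
    ring

/-- In the 1-dependent normal model, the log-likelihood `ℓ` (up to an additive constant)
has derivative `ℓ'(θ) = (1/((k+2)σ²))(k ∑ᵢ sᵢ + s₁ + sₙ − (k+1)(nk+2)θ)` and attains its
unique global maximum at `θ̂ = (k ∑ᵢ sᵢ + s₁ + sₙ)/((nk+2)(k+1))`. -/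
theorem deriv_loglik_and_unique_max
    (k : ℕ) (hk : 1 ≤ k) (σ2 : ℝ) (hσ2 : 0 < σ2) (n : ℕ) (hn : 2 ≤ n)
    (s : ℕ → ℝ) (ℓ : ℝ → ℝ)
    (hℓ : ∀ θ : ℝ, ℓ θ =
      -(s 1 - ((k : ℝ) + 1) * θ) ^ 2 / (2 * ((k : ℝ) + 1) * σ2)
        - (((k : ℝ) + 1) / (2 * (k : ℝ) * ((k : ℝ) + 2) * σ2))
          * ∑ i ∈ Finset.Icc 2 n,
              (s i - (((k : ℝ) + 1) * θ + (s (i - 1) - ((k : ℝ) + 1) * θ) / ((k : ℝ) + 1))) ^ 2)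
    (θhat : ℝ)
    (hθhat : θhat = ((k : ℝ) * ∑ i ∈ Finset.Icc 1 n, s i + s 1 + s n)
                      / (((n : ℝ) * k + 2) * ((k : ℝ) + 1))) :
    (∀ θ : ℝ, deriv ℓ θ =
        (1 / (((k : ℝ) + 2) * σ2))
          * ((k : ℝ) * ∑ i ∈ Finset.Icc 1 n, s i + s 1 + s n
              - ((k : ℝ) + 1) * ((n : ℝ) * k + 2) * θ))
      ∧ ∀ θ : ℝ, θ ≠ θhat → ℓ θ < ℓ θhat := by
  have hk0 : (0 : ℝ) < k := by exact_mod_cast hk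
  have hn0 : (0 : ℝ) < n := by exact_mod_cast (by omega : 0 < n)
  generalize (k : ℝ) = K at *
  have hK1 : K + 1 ≠ 0 := by positivity
  have hs := fun θ => sum_aux K θ hK1 s n (by omega)
  generalize ∑ i ∈ Finset.Icc 1 n, s i = S at *
  generalize ∑ i ∈ Finset.Icc 2 n, (s i - s (i - 1) / (K + 1)) ^ 2 = T at *
  generalize (n : ℝ) = N at *
  obtain ⟨C, hC⟩ : ∃ C : ℝ, ∀ θ, ℓ θ = C + (1 / ((K + 2) * σ2)) *
      ((K * S + s 1 + s n) * θ - (K + 1) * (N * K + 2) / 2 * θ ^ 2) := by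
    refine ⟨-(s 1) ^ 2 / (2 * (K + 1) * σ2) - ((K + 1) / (2 * K * (K + 2) * σ2)) * T, fun θ => ?_⟩
    rw [hℓ, hs]
    field_simp
    ring
  clear hs hℓ
  constructor
  · intro θ
    have h1 : HasDerivAt (fun θ : ℝ => C + (1 / ((K + 2) * σ2)) *
      ((K * S + s 1 + s n) * θ - (K + 1) * (N * K + 2) / 2 * θ ^ 2))
      ((1 / ((K + 2) * σ2)) *
      ((K * S + s 1 + s n) * 1 - (K + 1) * (N * K + 2) / 2 * (((2 : ℕ) : ℝ) * θ ^ (2 - 1)))) θ :=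
      ((((hasDerivAt_id θ).const_mul _).sub ((hasDerivAt_pow 2 θ).const_mul _)).const_mul
        _).const_add C
    rw [funext hC, h1.deriv]
    push_cast
    ring
  · intro θ hne
    have hB : K * S + s 1 + s n = θhat * ((N * K + 2) * (K + 1)) := by
      rw [hθhat]; field_simp
    have hd : 0 < (1 / ((K + 2) * σ2)) * ((K + 1) * (N * K + 2) / 2 * (θ - θhat) ^ 2) := by
      have : 0 < (θ - θhat) ^ 2 := by
        have := sub_ne_zero.mpr hne
        positivity
      positivity
    rw [hC, hC, hB, ← sub_pos]
    convert hd using 1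
    ring
end
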